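/- arXiv:0910.5115 — 12 statements merged into one kernel-verified Lean document; each statement's English description precedes it below -/
import Mathlib

section
/- For every real θ with 0 < θ ≤ π/2, one has 2/θ² − 5/6 ≤ cos θ/(1 − cos θ) ≤ 2/θ². -/
open Real

theorem nonneg_of_deriv_aux (f f' : ℝ → ℝ) (hf : ∀ x, HasDerivAt f (f' x) x) (h0 : f 0 = 0)
    (hp : ∀ x, 0 ≤ x → 0 ≤ f' x) (x : ℝ) (hx : 0 ≤ x) : 0 ≤ f x := by
  have hm : MonotoneOn f (Set.Ici 0) := by
    apply monotoneOn_of_deriv_nonneg (convex_Ici 0)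
    · exact fun y _ => (hf y).continuousAt.continuousWithinAt
    · exact fun y _ => (hf y).differentiableAt.differentiableWithinAt
    · intro y hy
      rw [interior_Ici] at hy
      rw [(hf y).deriv]
      exact hp y (le_of_lt hy)
  have := hm (Set.mem_Ici.2 le_rfl) (Set.mem_Ici.2 hx) hx
  linarith

theorem sin_lower_aux (x : ℝ) (hx : 0 ≤ x) : 0 ≤ sin x - (x - x ^ 3 / 6) := by
  refine nonneg_of_deriv_aux (fun x => sin x - (x - x ^ 3 / 6))
    (fun x => cos x - (1 - x ^ 2 / 2)) (fun y => ?_) (by simp) (fun y _ => ?_) x hx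
  · refine ((hasDerivAt_sin y).sub ((hasDerivAt_id y).sub
      ((hasDerivAt_pow 3 y).div_const 6))).congr_deriv ?_
    norm_num; ring
  · have := one_sub_sq_div_two_le_cos (x := y)
    linarith

theorem cos_upper_aux (x : ℝ) (hx : 0 ≤ x) : 0 ≤ (1 - x ^ 2 / 2 + x ^ 4 / 24) - cos x := by
  refine nonneg_of_deriv_aux (fun x => (1 - x ^ 2 / 2 + x ^ 4 / 24) - cos x)
    (fun x => sin x - (x - x ^ 3 / 6)) (fun y => ?_) (by simp) sin_lower_aux x hx
  refine (((((hasDerivAt_pow 2 y).div_const 2).const_sub 1).add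
      ((hasDerivAt_pow 4 y).div_const 24)).sub (hasDerivAt_cos y)).congr_deriv ?_
  norm_num; ring

theorem sin_upper_aux (x : ℝ) (hx : 0 ≤ x) : 0 ≤ (x - x ^ 3 / 6 + x ^ 5 / 120) - sin x := by
  refine nonneg_of_deriv_aux (fun x => (x - x ^ 3 / 6 + x ^ 5 / 120) - sin x)
    (fun x => (1 - x ^ 2 / 2 + x ^ 4 / 24) - cos x) (fun y => ?_) (by simp) cos_upper_aux x hx
  refine ((((hasDerivAt_id y).sub ((hasDerivAt_pow 3 y).div_const 6)).add
      ((hasDerivAt_pow 5 y).div_const 120)).sub (hasDerivAt_sin y)).congr_deriv ?_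
  norm_num; ring

theorem cos_lower_aux (x : ℝ) (hx : 0 ≤ x) :
    0 ≤ cos x - (1 - x ^ 2 / 2 + x ^ 4 / 24 - x ^ 6 / 720) := by
  refine nonneg_of_deriv_aux (fun x => cos x - (1 - x ^ 2 / 2 + x ^ 4 / 24 - x ^ 6 / 720))
    (fun x => (x - x ^ 3 / 6 + x ^ 5 / 120) - sin x) (fun y => ?_) (by simp) sin_upper_aux x hx
  refine ((hasDerivAt_cos y).sub (((((hasDerivAt_pow 2 y).div_const 2).const_sub 1).add
      ((hasDerivAt_pow 4 y).div_const 24)).sub ((hasDerivAt_pow 6 y).div_const 720))).congr_deriv ?_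
  norm_num; ring

theorem trig_bound_growth_speed (θ : ℝ) (h0 : 0 < θ) (h1 : θ ≤ π / 2) :
    2 / θ ^ 2 - 5 / 6 ≤ cos θ / (1 - cos θ) ∧ cos θ / (1 - cos θ) ≤ 2 / θ ^ 2 := by
  have hu := cos_upper_aux θ h0.le
  have hl := cos_lower_aux θ h0.le
  have hθ : θ ≤ 2 := by linarith [pi_le_four]
  obtain ⟨t, ht⟩ : ∃ t, t = θ ^ 2 := ⟨_, rfl⟩
  have e4 : θ ^ 4 = t ^ 2 := by rw [ht]; ring
  have e6 : θ ^ 6 = t ^ 3 := by rw [ht]; ring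
  have tpos : 0 < t := by rw [ht]; positivity
  have t4 : t ≤ 4 := by rw [ht]; nlinarith
  rw [e4, ← ht] at hu
  rw [e4, e6, ← ht] at hl
  rw [← ht]
  generalize cos θ = c at *
  have hc : 0 < 1 - c := by nlinarith
  have p2 : 0 ≤ t ^ 2 * (4 - t) := mul_nonneg (by positivity) (by linarith)
  have p3 : 0 ≤ t ^ 3 * (4 - t) := mul_nonneg (by positivity) (by linarith)
  have q3 : 0 < t ^ 3 := by positivity
  have q2 : 0 < t ^ 2 := by positivity
  constructor
  · have e : 2 / t - 5 / 6 = (12 - 5 * t) / (6 * t) := by field_simp; ring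
    rw [e, div_le_div_iff₀ (by positivity) hc]
    have := mul_nonneg hl (by linarith : 0 ≤ 12 + t)
    nlinarith
  · rw [div_le_div_iff₀ hc tpos]
    have := mul_nonneg hu (by linarith : 0 ≤ 2 + t)
    nlinarith
end

section
/- The function g(a) = a·sin(a)/(1 − cos(a)) is strictly positive and strictly decreasing on the interval (0, π/2]. Equivalently, the function f(x) = log(1 − cos(eˣ)) satisfies f′(x) > 0 and f″(x) < 0 for all x < log(π/2). -/
open Real

/-- `g a = a * sin a / (1 - cos a)`, the growth-process comparison function. -/
noncomputable def g (a : ℝ) : ℝ := a * Real.sin a / (1 - Real.cos a)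

/-- `f x = log (1 - cos (exp x))`, so that `g a = f' (log a)`. -/
noncomputable def f (x : ℝ) : ℝ := Real.log (1 - Real.cos (Real.exp x))

theorem aux_cos {a : ℝ} (h0 : 0 < a) (h1 : a ≤ π / 2) : 0 < 1 - Real.cos a := by
  have h := Real.cos_lt_cos_of_nonneg_of_le_pi_div_two le_rfl h1 h0
  rw [Real.cos_zero] at h
  linarith

theorem aux_sin {a : ℝ} (h0 : 0 < a) (h1 : a ≤ π / 2) : 0 < Real.sin a :=
  Real.sin_pos_of_pos_of_lt_pi h0 (by linarith [Real.pi_pos])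

theorem aux_g_pos {a : ℝ} (h0 : 0 < a) (h1 : a ≤ π / 2) : 0 < g a :=
  div_pos (mul_pos h0 (aux_sin h0 h1)) (aux_cos h0 h1)

theorem aux_g_deriv {a : ℝ} (h0 : 0 < a) (h1 : a ≤ π / 2) :
    HasDerivAt g ((Real.sin a - a) / (1 - Real.cos a)) a := by
  have hc := aux_cos h0 h1
  have h := ((hasDerivAt_id a).mul (Real.hasDerivAt_sin a)).div
    ((Real.hasDerivAt_cos a).const_sub 1) hc.ne'
  refine HasDerivAt.congr_deriv (f := g) h ?_
  simp only [id, Pi.mul_apply]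
  rw [div_eq_div_iff (by positivity) hc.ne']
  have hs := Real.sin_sq_add_cos_sq a
  have hs2 : Real.sin a ^ 2 = 1 - Real.cos a ^ 2 := by linarith
  linear_combination (-(a * (1 - Real.cos a))) * hs2

theorem aux_deriv_neg {a : ℝ} (h0 : 0 < a) (h1 : a ≤ π / 2) :
    (Real.sin a - a) / (1 - Real.cos a) < 0 :=
  div_neg_of_neg_of_pos (by linarith [Real.sin_lt h0]) (aux_cos h0 h1)

theorem aux_f_deriv {x : ℝ} (hx : x < Real.log (π / 2)) : HasDerivAt f (g (Real.exp x)) x := by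
  have h1 : Real.exp x < π / 2 := (Real.lt_log_iff_exp_lt (by positivity)).1 hx
  have hc := aux_cos (Real.exp_pos x) h1.le
  have h := (((Real.hasDerivAt_exp x).cos).const_sub 1).log hc.ne'
  refine HasDerivAt.congr_deriv (f := f) h ?_
  unfold g
  ring

theorem g_pos_strictAnti_and_f_deriv :
    ((∀ a ∈ Set.Ioc (0 : ℝ) (π / 2), 0 < g a) ∧
      StrictAntiOn g (Set.Ioc (0 : ℝ) (π / 2))) ∧
    (∀ x : ℝ, x < Real.log (π / 2) →
      0 < deriv f x ∧ deriv (deriv f) x < 0) := by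
  refine ⟨⟨fun a ha => aux_g_pos ha.1 ha.2, ?_⟩, fun x hx => ?_⟩
  · refine strictAntiOn_of_deriv_neg (convex_Ioc _ _)
      (fun a ha => (aux_g_deriv ha.1 ha.2).continuousAt.continuousWithinAt) ?_
    intro a ha
    have ha2 := interior_subset ha
    rw [(aux_g_deriv ha2.1 ha2.2).deriv]
    exact aux_deriv_neg ha2.1 ha2.2
  · have h1 : Real.exp x < π / 2 := (Real.lt_log_iff_exp_lt (by positivity)).1 hx
    have h0 := Real.exp_pos x
    refine ⟨(aux_f_deriv hx).deriv ▸ aux_g_pos h0 h1.le, ?_⟩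
    have he : deriv f =ᶠ[nhds x] fun y => g (Real.exp y) := by
      filter_upwards [Iio_mem_nhds hx] with y hy
      exact (aux_f_deriv hy).deriv
    have hd : HasDerivAt (fun y => g (Real.exp y)) _ x :=
      (aux_g_deriv h0 h1.le).comp x (Real.hasDerivAt_exp x)
    rw [he.deriv_eq, hd.deriv]
    exact mul_neg_of_neg_of_pos (aux_deriv_neg h0 h1.le) h0
end

section
/- For every a with 0 < a ≤ π/2 one has π/2 ≤ g(a) < 2, where g(a) = a·sin(a)/(1 − cos(a)); moreover g(a) → 2 as a → 0⁺. -/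
open Real Filter

theorem one_sub_cos_pos_aux {a : ℝ} (h : 0 < a) (h2 : a ≤ π / 2) : 0 < 1 - Real.cos a := by
  have hpi := Real.pi_pos
  have := Real.cos_lt_cos_of_nonneg_of_le_pi_div_two le_rfl h2 h
  rw [Real.cos_zero] at this
  linarith

theorem g_hasDerivAt {a : ℝ} (h : 0 < a) (h2 : a ≤ π / 2) :
    HasDerivAt g ((Real.sin a - a) / (1 - Real.cos a)) a := by
  have hc := one_sub_cos_pos_aux h h2
  have := ((hasDerivAt_id a).mul (Real.hasDerivAt_sin a)).div
    ((Real.hasDerivAt_cos a).const_sub 1) hc.ne'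
  refine HasDerivAt.congr_deriv (f := g) this ?_
  simp only [id, Pi.mul_apply]
  rw [div_eq_div_iff (pow_pos hc 2).ne' hc.ne']
  have hs := Real.sin_sq_add_cos_sq a
  linear_combination (-a * (1 - Real.cos a)) * hs

theorem g_half {a : ℝ} (h : 0 < a) (h2 : a ≤ π / 2) :
    g a = 2 * Real.cos (a / 2) / Real.sinc (a / 2) := by
  have hpi := Real.pi_pos
  have hs : 0 < Real.sin (a / 2) := Real.sin_pos_of_pos_of_lt_pi (by linarith) (by linarith)
  have hc := one_sub_cos_pos_aux h h2
  have e1 : Real.sin a = 2 * Real.sin (a / 2) * Real.cos (a / 2) := by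
    rw [← Real.sin_two_mul]; congr 1; ring
  have e2 : 1 - Real.cos a = 2 * Real.sin (a / 2) ^ 2 := by
    have : Real.cos a = Real.cos (2 * (a / 2)) := by congr 1; ring
    rw [this, Real.cos_two_mul, Real.cos_sq']; ring
  rw [g, e1, e2, Real.sinc_of_ne_zero (by positivity)]
  field_simp

theorem g_bounds_and_limit :
    (∀ a : ℝ, 0 < a → a ≤ π / 2 → π / 2 ≤ g a ∧ g a < 2) ∧
    Tendsto g (nhdsWithin 0 (Set.Ioi 0)) (nhds 2) := by
  have hpi := Real.pi_pos
  refine ⟨fun a h h2 => ⟨?_, ?_⟩, ?_⟩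
  · have hanti : AntitoneOn g (Set.Ioc 0 (π / 2)) := by
      apply antitoneOn_of_deriv_nonpos (convex_Ioc _ _)
      · intro x hx
        exact (g_hasDerivAt hx.1 hx.2).continuousAt.continuousWithinAt
      · intro x hx
        have hx := interior_subset hx
        exact (g_hasDerivAt hx.1 hx.2).differentiableAt.differentiableWithinAt
      · intro x hx
        have hx := interior_subset hx
        rw [(g_hasDerivAt hx.1 hx.2).deriv]
        exact div_nonpos_of_nonpos_of_nonneg (by linarith [Real.sin_lt hx.1])
          (one_sub_cos_pos_aux hx.1 hx.2).le
    have := hanti ⟨h, h2⟩ ⟨by positivity, le_rfl⟩ h2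
    simpa [g] using this
  · have hs : 0 < Real.sin (a / 2) := Real.sin_pos_of_pos_of_lt_pi (by linarith) (by linarith)
    have hc : 0 < Real.cos (a / 2) := Real.cos_pos_of_mem_Ioo ⟨by linarith, by linarith⟩
    have ht := Real.lt_tan (x := a / 2) (by linarith) (by linarith)
    rw [Real.tan_eq_sin_div_cos, lt_div_iff₀ hc] at ht
    rw [g_half h h2, Real.sinc_of_ne_zero (by positivity), div_lt_iff₀ (by positivity),
      mul_lt_mul_iff_right₀ two_pos, lt_div_iff₀ (by positivity)]
    linarith
  · have hcont : ContinuousAt (fun a : ℝ => 2 * Real.cos (a / 2) / Real.sinc (a / 2)) 0 := by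
      apply ContinuousAt.div
      · fun_prop
      · exact (Real.continuous_sinc.comp (continuous_id.div_const 2)).continuousAt
      · simp
    have ht := hcont.tendsto.mono_left (nhdsWithin_le_nhds (s := Set.Ioi 0))
    simp only [zero_div, Real.cos_zero, Real.sinc_zero, mul_one, div_one] at ht
    refine ht.congr' ?_
    have hm : Set.Ioc (0 : ℝ) (π / 2) ∈ nhdsWithin 0 (Set.Ioi 0) :=
      Ioc_mem_nhdsGT (by positivity)
    filter_upwards [hm] with x hx
    exact (g_half hx.1 hx.2).symm
end

section
/- Let 0 < c < a ≤ π/2, set J = log((1 − cos a)/(1 − cos c)) (so J > 0), and let g(a) = a·sin(a)/(1 − cos(a)). Then −log(1 − exp(−2J/π)) ≤ −log(1 − exp(−J/g(a))) ≤ −log(1 − c/a) ≤ −log(1 − exp(−J/2)). -/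
open Real

theorem g_pos_den {t : ℝ} (h0 : 0 < t) (h1 : t ≤ π / 2) : 0 < 1 - Real.cos t := by
  have h := Real.cos_lt_cos_of_nonneg_of_le_pi_div_two (le_refl 0) h1 h0
  rw [Real.cos_zero] at h
  linarith

theorem g_hasDeriv {t : ℝ} (h0 : 0 < t) (h1 : t ≤ π / 2) :
    HasDerivAt g ((Real.sin t - t) / (1 - Real.cos t)) t := by
  have hd := g_pos_den h0 h1
  have h := ((hasDerivAt_id t).mul (Real.hasDerivAt_sin t)).div
    ((Real.hasDerivAt_cos t).const_sub 1) hd.ne'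
  refine HasDerivAt.congr_deriv (f := g) h ?_
  simp only [id, Pi.mul_apply]
  field_simp
  have := Real.sin_sq_add_cos_sq t
  linear_combination (-t) * this

theorem g_anti : AntitoneOn g (Set.Ioc 0 (π / 2)) := by
  refine antitoneOn_of_deriv_nonpos (convex_Ioc _ _) ?_ ?_ ?_
  · intro t ht
    exact (g_hasDeriv ht.1 ht.2).continuousAt.continuousWithinAt
  · intro t ht
    rw [interior_Ioc] at ht
    exact (g_hasDeriv ht.1 ht.2.le).differentiableAt.differentiableWithinAt
  · intro t ht
    rw [interior_Ioc] at ht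
    rw [(g_hasDeriv ht.1 ht.2.le).deriv]
    exact div_nonpos_of_nonpos_of_nonneg (by linarith [Real.sin_le ht.1.le])
      (g_pos_den ht.1 ht.2.le).le

theorem g_le_two {t : ℝ} (h0 : 0 < t) (h1 : t ≤ π / 2) : g t ≤ 2 := by
  have hd := g_pos_den h0 h1
  unfold g
  rw [div_le_iff₀ hd]
  have hp := Real.pi_pos
  have hx := Real.le_tan (x := t / 2) (by linarith) (by linarith)
  have hcos : 0 < Real.cos (t / 2) := Real.cos_pos_of_mem_Ioo ⟨by linarith, by linarith⟩
  have hsin : 0 < Real.sin (t / 2) := Real.sin_pos_of_pos_of_lt_pi (by linarith) (by linarith)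
  rw [Real.tan_eq_sin_div_cos, le_div_iff₀ hcos] at hx
  have e1 : Real.sin t = 2 * Real.sin (t / 2) * Real.cos (t / 2) := by
    rw [← Real.sin_two_mul]; congr 1; ring
  have e2 : Real.cos t = 1 - 2 * Real.sin (t / 2) ^ 2 := by
    have := Real.cos_two_mul (t / 2)
    rw [show 2 * (t / 2) = t by ring] at this
    have := Real.sin_sq_add_cos_sq (t / 2)
    linarith
  rw [e1, e2]
  nlinarith [mul_le_mul_of_nonneg_right hx hsin.le]

theorem h_hasDeriv (G : ℝ) {t : ℝ} (h0 : 0 < t) (h1 : t ≤ π / 2) :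
    HasDerivAt (fun t => Real.log (1 - Real.cos t) - G * Real.log t) ((g t - G) / t) t := by
  have hd := g_pos_den h0 h1
  have h := (((Real.hasDerivAt_cos t).const_sub 1).log hd.ne').sub
    ((Real.hasDerivAt_log h0.ne').const_mul G)
  refine h.congr_deriv ?_
  unfold g
  field_simp

theorem jump_coupling_inequalities (a c J : ℝ)
    (hc : 0 < c) (hca : c < a) (ha : a ≤ π / 2)
    (hJ : J = Real.log ((1 - Real.cos a) / (1 - Real.cos c))) :
    0 < J ∧
    -Real.log (1 - Real.exp (-(2 * J / π))) ≤ -Real.log (1 - Real.exp (-(J / g a))) ∧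
    -Real.log (1 - Real.exp (-(J / g a))) ≤ -Real.log (1 - c / a) ∧
    -Real.log (1 - c / a) ≤ -Real.log (1 - Real.exp (-(J / 2))) := by
  have ha0 : 0 < a := hc.trans hca
  have hp := Real.pi_pos
  have hda := g_pos_den ha0 ha
  have hdc := g_pos_den hc (hca.le.trans ha)
  have hJ0 : 0 < J := by
    rw [hJ]
    apply Real.log_pos
    rw [one_lt_div hdc]
    have := Real.cos_lt_cos_of_nonneg_of_le_pi_div_two hc.le ha hca
    linarith
  have hJ' : J = Real.log (1 - Real.cos a) - Real.log (1 - Real.cos c) := by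
    rw [hJ, Real.log_div hda.ne' hdc.ne']
  have hga : π / 2 ≤ g a := by
    have := g_anti ⟨ha0, ha⟩ ⟨by linarith, le_refl (π / 2)⟩ ha
    simpa [g] using this
  have hg0 : 0 < g a := by linarith
  have hmem : ∀ t ∈ Set.Icc c a, 0 < t ∧ t ≤ π / 2 :=
    fun t ht => ⟨hc.trans_le ht.1, ht.2.trans ha⟩
  have hcont : ∀ G : ℝ, ContinuousOn
      (fun t => Real.log (1 - Real.cos t) - G * Real.log t) (Set.Icc c a) := fun G t ht =>
    (h_hasDeriv G (hmem t ht).1 (hmem t ht).2).continuousAt.continuousWithinAt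
  have hdiff : ∀ G : ℝ, DifferentiableOn ℝ
      (fun t => Real.log (1 - Real.cos t) - G * Real.log t) (interior (Set.Icc c a)) :=
    fun G t ht => by
      have ht := hmem t (interior_subset ht)
      exact (h_hasDeriv G ht.1 ht.2).differentiableAt.differentiableWithinAt
  have hmono := monotoneOn_of_deriv_nonneg (convex_Icc c a) (hcont (g a)) (hdiff (g a))
    (fun t ht => by
      have ht1 := interior_subset ht
      have ht := hmem t ht1
      rw [(h_hasDeriv (g a) ht.1 ht.2).deriv]
      exact div_nonneg (by linarith [g_anti ht ⟨ha0, ha⟩ ht1.2]) ht.1.le)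
  have hanti := antitoneOn_of_deriv_nonpos (convex_Icc c a) (hcont 2) (hdiff 2)
    (fun t ht => by
      have ht := hmem t (interior_subset ht)
      rw [(h_hasDeriv 2 ht.1 ht.2).deriv]
      exact div_nonpos_of_nonpos_of_nonneg (by linarith [g_le_two ht.1 ht.2]) ht.1.le)
  have m1 := hmono (Set.left_mem_Icc.2 hca.le) (Set.right_mem_Icc.2 hca.le) hca.le
  have m2 := hanti (Set.left_mem_Icc.2 hca.le) (Set.right_mem_Icc.2 hca.le) hca.le
  simp only at m1 m2
  have hce : c / a = Real.exp (Real.log c - Real.log a) := by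
    rw [Real.exp_sub, Real.exp_log hc, Real.exp_log ha0]
  have key : ∀ x y : ℝ, x ≤ y → y < 1 → -Real.log (1 - x) ≤ -Real.log (1 - y) := by
    intro x y hxy hy
    exact neg_le_neg (Real.log_le_log (by linarith) (by linarith))
  refine ⟨hJ0, key _ _ ?_ ?_, key _ _ ?_ ?_, key _ _ ?_ ?_⟩
  · apply Real.exp_le_exp.2
    apply neg_le_neg
    rw [div_le_div_iff₀ hg0 hp]
    nlinarith
  · rw [Real.exp_lt_one_iff]
    have := div_pos hJ0 hg0
    linarith
  · rw [hce]
    apply Real.exp_le_exp.2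
    have : Real.log a - Real.log c ≤ J / g a := by
      rw [le_div_iff₀ hg0]
      linarith
    linarith
  · rwa [div_lt_one ha0]
  · rw [hce]
    apply Real.exp_le_exp.2
    linarith
  · rw [Real.exp_lt_one_iff]
    linarith
end

section
/- Let 0 < a ≤ π/2 and J > 0, and set g(a) = a·sin(a)/(1 − cos(a)). Then log((1 − exp(−J/g(a)))/(1 − exp(−J/2))) ≤ ((J/2)/(e^{J/2} − 1)) · (a²/2) ≤ a²/2. -/
open Real

theorem jump_discrepancy_bound (a J : ℝ) (h0 : 0 < a) (h1 : a ≤ π / 2) (hJ : 0 < J) :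
    Real.log ((1 - Real.exp (-(J / g a))) / (1 - Real.exp (-(J / 2))))
        ≤ (J / 2) / (Real.exp (J / 2) - 1) * (a ^ 2 / 2) ∧
      (J / 2) / (Real.exp (J / 2) - 1) * (a ^ 2 / 2) ≤ a ^ 2 / 2 := by
  have hpi := Real.pi_lt_four
  obtain ⟨t, rfl⟩ : ∃ t, a = 2 * t := ⟨a / 2, by ring⟩
  have ht : 0 < t := by linarith
  have ht1 : t < 1 := by linarith
  have hs : 0 < Real.sin t := Real.sin_pos_of_pos_of_lt_pi ht (by linarith [Real.pi_gt_three])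
  have hst : Real.sin t < t := Real.sin_lt ht
  have hc : 1 - t ^ 2 / 2 ≤ Real.cos t := Real.one_sub_sq_div_two_le_cos
  have hcp : 0 < Real.cos t := by nlinarith
  have hg : g (2 * t) = 2 * t * Real.cos t / Real.sin t := by
    unfold g
    have e : 1 - Real.cos (2 * t) = 2 * Real.sin t ^ 2 := by
      rw [Real.cos_two_mul]; nlinarith [Real.sin_sq_add_cos_sq t]
    rw [e, Real.sin_two_mul]
    field_simp
  have hgp : 0 < g (2 * t) := by rw [hg]; positivity
  have hd : J / g (2 * t) - J / 2 ≤ J / 2 * ((2 * t) ^ 2 / 2) := by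
    have : J / g (2 * t) ≤ J / 2 * (1 + 2 * t ^ 2) := by
      rw [hg, div_le_iff₀ (by positivity)]
      have h2 : 1 ≤ Real.cos t * (1 + 2 * t ^ 2) := by
        have : (1 - t ^ 2 / 2) * (1 + 2 * t ^ 2) ≤ Real.cos t * (1 + 2 * t ^ 2) :=
          mul_le_mul_of_nonneg_right hc (by positivity)
        have h3 : t ^ 2 ≤ 1 := by nlinarith
        nlinarith [mul_nonneg (sq_nonneg t) (sub_nonneg.2 h3)]
      have h3 : 1 ≤ t * (Real.cos t * (1 + 2 * t ^ 2)) / Real.sin t := by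
        rw [le_div_iff₀ hs]
        nlinarith
      calc J = J * 1 := by ring
        _ ≤ J * (t * (Real.cos t * (1 + 2 * t ^ 2)) / Real.sin t) := by gcongr
        _ = _ := by ring
    linarith
  have hdp : 0 < J / g (2 * t) := by positivity
  generalize J / g (2 * t) = d at hd hdp
  obtain ⟨c, rfl⟩ : ∃ c, J = 2 * c := ⟨J / 2, by ring⟩
  have hcc : 2 * c / 2 = c := by ring
  rw [hcc] at hd ⊢
  have hcpos : 0 < c := by linarith
  have hE : c ≤ Real.exp c - 1 := by linarith [Real.add_one_le_exp c]
  have hEp : 0 < Real.exp c - 1 := by linarith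
  have hu : 0 < 1 - Real.exp (-c) := by
    have : Real.exp (-c) < 1 := by rw [← Real.exp_zero]; exact Real.exp_lt_exp.2 (by linarith)
    linarith
  have hv : 0 < 1 - Real.exp (-d) := by
    have : Real.exp (-d) < 1 := by rw [← Real.exp_zero]; exact Real.exp_lt_exp.2 (by linarith)
    linarith
  constructor
  · have e1 : (1 - Real.exp (-d)) / (1 - Real.exp (-c)) - 1
        = (1 - Real.exp (c - d)) / (Real.exp c - 1) := by
      rw [div_sub_one hu.ne', div_eq_div_iff hu.ne' hEp.ne']
      have h1 : Real.exp (c - d) = Real.exp c * Real.exp (-d) := by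
        rw [← Real.exp_add]; ring_nf
      have h2 : Real.exp c * Real.exp (-c) = 1 := by
        rw [← Real.exp_add]; simp
      rw [h1]
      linear_combination (1 - Real.exp (-d)) * h2
    calc _ ≤ (1 - Real.exp (-d)) / (1 - Real.exp (-c)) - 1 :=
          Real.log_le_sub_one_of_pos (by positivity)
      _ = (1 - Real.exp (c - d)) / (Real.exp c - 1) := e1
      _ ≤ (c * ((2 * t) ^ 2 / 2)) / (Real.exp c - 1) := by
          gcongr
          linarith [Real.add_one_le_exp (c - d)]
      _ = _ := by ring
  · have : c / (Real.exp c - 1) ≤ 1 := by rw [div_le_one hEp]; exact hE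
    exact mul_le_of_le_one_left (by positivity) this
end

section
/- The integral ∫₀^∞ ((√(v²+4) − v)/(√(v²+4) + 3v))² · v dv equals log 4 − 5/4. -/
open Real MeasureTheory

theorem lower_bound_constant_integral :
    (∫ v in Set.Ioi (0 : ℝ),
        ((Real.sqrt (v ^ 2 + 4) - v) / (Real.sqrt (v ^ 2 + 4) + 3 * v)) ^ 2 * v)
      = Real.log 4 - 5 / 4 := by
  have key : ∀ v : ℝ, 0 ≤ v → ∃ t : ℝ, 0 < t ∧ t ≤ 1 ∧ v = 1 / t - t ∧
      √(v ^ 2 + 4) = 1 / t + t ∧ (√(v ^ 2 + 4) - v) / 2 = t := by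
    intro v hv
    have hs : √(v ^ 2 + 4) ^ 2 = v ^ 2 + 4 := Real.sq_sqrt (by positivity)
    have hs0 : 0 ≤ √(v ^ 2 + 4) := Real.sqrt_nonneg _
    generalize √(v ^ 2 + 4) = s at *
    have h1 : 0 < (s - v) / 2 := by nlinarith
    have h2 : 1 / ((s - v) / 2) = (s + v) / 2 := by
      rw [div_eq_iff h1.ne']; nlinarith
    refine ⟨(s - v) / 2, h1, by nlinarith, ?_, ?_, rfl⟩ <;> rw [h2] <;> ring
  have hw : Filter.Tendsto (fun v : ℝ => 2 - ((√(v ^ 2 + 4) - v) / 2) ^ 2) Filter.atTop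
      (nhds 2) := by
    have h0 : Filter.Tendsto (fun v : ℝ => (√(v ^ 2 + 4) - v) / 2) Filter.atTop (nhds 0) := by
      have hi : Filter.Tendsto (fun v : ℝ => v⁻¹) Filter.atTop (nhds 0) :=
        tendsto_inv_atTop_zero
      refine tendsto_of_tendsto_of_tendsto_of_le_of_le' tendsto_const_nhds hi ?_ ?_
      · filter_upwards [Filter.eventually_gt_atTop 0] with v hv
        obtain ⟨t, h0, h1, hvt, hst, htt⟩ := key v hv.le
        rw [htt]; exact h0.le
      · filter_upwards [Filter.eventually_gt_atTop 0] with v hv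
        obtain ⟨t, h0, h1, hvt, hst, htt⟩ := key v hv.le
        rw [htt, ← one_div, le_div_iff₀ hv, hvt]
        have : t * (1 / t - t) = 1 - t ^ 2 := by field_simp
        rw [this]; nlinarith
    simpa using (h0.pow 2).const_sub 2
  have hG : Filter.Tendsto (fun v : ℝ => (1 / 2 : ℝ) *
      (3 * (2 - ((√(v ^ 2 + 4) - v) / 2) ^ 2)⁻¹ +
        4 * Real.log (2 - ((√(v ^ 2 + 4) - v) / 2) ^ 2)
        - (2 - ((√(v ^ 2 + 4) - v) / 2) ^ 2))) Filter.atTop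
      (nhds ((1 / 2 : ℝ) * (3 * 2⁻¹ + 4 * Real.log 2 - 2))) :=
    ((((hw.inv₀ two_ne_zero).const_mul 3).add ((hw.log two_ne_zero).const_mul 4)).sub
      hw).const_mul _
  have hlog : Real.log 4 = 2 * Real.log 2 := by
    rw [show (4 : ℝ) = 2 ^ 2 by norm_num, Real.log_pow]; norm_num
  rw [integral_Ioi_of_hasDerivAt_of_nonneg' ?_ ?_ hG]
  · have : √(4 : ℝ) = 2 := by
      rw [show (4 : ℝ) = 2 ^ 2 by norm_num]; exact Real.sqrt_sq (by norm_num)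
    norm_num [this, hlog]
    ring
  · intro v hv
    obtain ⟨t, h0, h1, hvt, hst, htt⟩ := key v hv
    have hsq : HasDerivAt (fun v : ℝ => √(v ^ 2 + 4)) ((2 * v) / (2 * √(v ^ 2 + 4))) v := by
      refine HasDerivAt.sqrt ?_ (by positivity)
      simpa using (hasDerivAt_pow 2 v).add_const 4
    have hwd := ((((hsq.sub (hasDerivAt_id v)).div_const 2).pow 2).const_sub 2)
    have hw0 : 2 - ((√(v ^ 2 + 4) - v) / 2) ^ 2 ≠ 0 := by
      rw [htt]; nlinarith
    have := ((((hwd.inv hw0).const_mul 3).add ((hwd.log hw0).const_mul 4)).sub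
      hwd).const_mul (1 / 2 : ℝ)
    refine this.congr_deriv ?_
    have h2 : 2 - t ^ 2 ≠ 0 := by nlinarith
    have h3 : 1 + t ^ 2 ≠ 0 := by positivity
    simp only [Pi.sub_apply, Pi.pow_apply, id, htt]
    rw [hst]
    have e1 : (1 / t + t - v) / (1 / t + t + 3 * v) = t ^ 2 / (2 - t ^ 2) := by
      rw [hvt]
      have : 1 / t + t + 3 * (1 / t - t) = 2 * (2 - t ^ 2) / t := by field_simp; ring
      rw [this]; field_simp; ring
    have e2 : (2 * v / (2 * (1 / t + t)) - 1) / 2 = - t ^ 2 / (1 + t ^ 2) := by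
      rw [hvt]
      have : 1 / t + t = (1 + t ^ 2) / t := by field_simp
      rw [this]; field_simp; ring
    have e3 : (1 / t + t - v) / 2 = t := by rw [hvt]; ring
    rw [e1]
    simp only [e2, e3]
    rw [hvt]
    field_simp
    ring
  · intro v hv
    have : (0 : ℝ) < v := hv
    positivity
end

section
/- For n > 0, 0 < x < n and y > 0, set d₁ = √(x² + y²), d₂ = √((n−x)² + y²), and ρₙ(x, y) = (1/4)·[ (y/d₁)·(1 − (n−x)/d₂) + (y/d₂)·(1 − x/d₁) ]·exp(−(1/2)(d₁ + d₂ − n)). Then for every fixed u ∈ (0,1) and v > 0, n^{3/2}·ρₙ(n·u, √n·v) converges as n → ∞ to (1/8)·(v³/(u²(1−u)²))·exp(−v²/(4u(1−u))). -/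
open Real Filter

/-- Intensity of the point process of maximal lateral displacement of the cell
boundary `∂C(p⁻, p⁺)` for `p⁻ = (0,0)`, `p⁺ = (n,0)`. -/
noncomputable def rho (n x y : ℝ) : ℝ :=
  (1 / 4) *
    ((y / Real.sqrt (x ^ 2 + y ^ 2)) *
        (1 - (n - x) / Real.sqrt ((n - x) ^ 2 + y ^ 2)) +
      (y / Real.sqrt ((n - x) ^ 2 + y ^ 2)) *
        (1 - x / Real.sqrt (x ^ 2 + y ^ 2))) *
    Real.exp (-(1 / 2) * (Real.sqrt (x ^ 2 + y ^ 2) +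
      Real.sqrt ((n - x) ^ 2 + y ^ 2) - n))

/-- Scaling of the distance. -/
theorem aux_sqrt (n w v : ℝ) (hn : 0 < n) :
    Real.sqrt ((n * w) ^ 2 + (Real.sqrt n * v) ^ 2) = n * Real.sqrt (w ^ 2 + v ^ 2 / n) := by
  have h : (n * w) ^ 2 + (Real.sqrt n * v) ^ 2 = n ^ 2 * (w ^ 2 + v ^ 2 / n) := by
    rw [mul_pow (Real.sqrt n), Real.sq_sqrt hn.le]
    field_simp
  rw [h, Real.sqrt_mul (by positivity), Real.sqrt_sq hn.le]

theorem aux_tendsto (w v : ℝ) (hw : 0 < w) :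
    Tendsto (fun n : ℝ => Real.sqrt (w ^ 2 + v ^ 2 / n)) atTop (nhds w) := by
  have h1 : Tendsto (fun n : ℝ => w ^ 2 + v ^ 2 / n) atTop (nhds (w ^ 2 + 0)) :=
    tendsto_const_nhds.add (tendsto_const_nhds.div_atTop tendsto_id)
  have h2 := h1.sqrt
  rwa [add_zero, Real.sqrt_sq hw.le] at h2

theorem aux_diff (n w v : ℝ) (hn : 0 < n) (hw : 0 < w) :
    n * (Real.sqrt (w ^ 2 + v ^ 2 / n) - w) = v ^ 2 / (Real.sqrt (w ^ 2 + v ^ 2 / n) + w) := by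
  have h : Real.sqrt (w ^ 2 + v ^ 2 / n) ^ 2 = w ^ 2 + v ^ 2 / n := Real.sq_sqrt (by positivity)
  have h0 := Real.sqrt_nonneg (w ^ 2 + v ^ 2 / n)
  generalize Real.sqrt (w ^ 2 + v ^ 2 / n) = S at *
  rw [eq_div_iff (by positivity)]
  have : v ^ 2 = n * (S ^ 2 - w ^ 2) := by rw [h]; field_simp; ring
  rw [this]; ring

theorem lateral_displacement_density_limit (u v : ℝ) (hu : u ∈ Set.Ioo (0 : ℝ) 1)
    (hv : 0 < v) :
    Tendsto (fun n : ℝ => n ^ ((3 : ℝ) / 2) * rho n (n * u) (Real.sqrt n * v)) atTop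
      (nhds ((1 / 8) * (v ^ 3 / (u ^ 2 * (1 - u) ^ 2)) *
        Real.exp (-(v ^ 2 / (4 * u * (1 - u)))))) := by
  obtain ⟨hu0, hu1⟩ := hu
  obtain ⟨w, hw⟩ : ∃ w, w = 1 - u := ⟨_, rfl⟩
  have hw0 : 0 < w := by linarith
  rw [← hw]
  have t1 := aux_tendsto u v hu0
  have t2 := aux_tendsto w v hw0
  have e1 := (tendsto_const_nhds (x := v ^ 2)).div (t1.add_const u) (by positivity)
  have e2 := (tendsto_const_nhds (x := v ^ 2)).div (t2.add_const w) (by positivity)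
  have main := ((((tendsto_const_nhds (x := v)).div t1 hu0.ne').mul (e2.div t2 hw0.ne')).add
    (((tendsto_const_nhds (x := v)).div t2 hw0.ne').mul (e1.div t1 hu0.ne'))).const_mul (1 / 4)
  have main2 := main.mul ((Real.continuous_exp.tendsto _).comp
    ((e1.add e2).const_mul (-(1 / 2))))
  refine (main2.congr' ?_).trans (le_of_eq ?_)
  · filter_upwards [eventually_gt_atTop 0] with n hn
    have hx : n - n * u = n * w := by rw [hw]; ring
    simp only [rho, hx, aux_sqrt n _ v hn, Function.comp, Pi.div_apply]
    have d1 := aux_diff n u v hn hu0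
    have d2 := aux_diff n w v hn hw0
    rw [← d1, ← d2]
    have p1 : 0 < Real.sqrt (u ^ 2 + v ^ 2 / n) := by positivity
    have p2 : 0 < Real.sqrt (w ^ 2 + v ^ 2 / n) := by positivity
    generalize Real.sqrt (u ^ 2 + v ^ 2 / n) = S at *
    generalize Real.sqrt (w ^ 2 + v ^ 2 / n) = T at *
    have hpow : n ^ ((3 : ℝ) / 2) = Real.sqrt n ^ 3 := by
      rw [Real.sqrt_eq_rpow, ← Real.rpow_natCast, ← Real.rpow_mul hn.le]
      norm_num
    have hE : n * (S - u) + n * (T - w) = n * S + n * T - n := by rw [hw]; ring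
    rw [hpow, hE, ← mul_assoc]
    congr 1
    have hr : 0 < Real.sqrt n := Real.sqrt_pos.2 hn
    have hr2 : n = Real.sqrt n ^ 2 := (Real.sq_sqrt hn.le).symm
    generalize Real.sqrt n = r at *
    subst hr2
    field_simp
  · congr 1
    have hE : -(1 / 2) * (v ^ 2 / (u + u) + v ^ 2 / (w + w)) = -(v ^ 2 / (4 * u * w)) := by
      have : w + u = 1 := by linarith
      field_simp
      linear_combination (-4) * this
    rw [hE]
    congr 1
    have : w + u = 1 := by linarith
    field_simp
    linear_combination 8 * this
end

section
/- Define for n > 0 the triple integral I(n) = ∫₀^π ∫₀^n ∫₀^n exp(−(1/2)(r + s − √(r² + s² + 2rs·cos θ))) · r·s·θ dr ds dθ. Then I(n)/n³ → 2 as n → ∞. -/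
open Real Filter MeasureTheory

/-- Mean traffic flow through the centre of a Poissonian city of radius `n`. -/
noncomputable def meanFlow (n : ℝ) : ℝ :=
  ∫ θ in (0 : ℝ)..π, ∫ s in (0 : ℝ)..n, ∫ r in (0 : ℝ)..n,
    Real.exp (-(1 / 2) * (r + s - Real.sqrt (r ^ 2 + s ^ 2 + 2 * r * s * Real.cos θ)))
      * r * s * θ

/-- The integrand. -/
noncomputable def flowF (r s θ : ℝ) : ℝ :=
  Real.exp (-(1 / 2) * (r + s - Real.sqrt (r ^ 2 + s ^ 2 + 2 * r * s * Real.cos θ))) * r * s * θ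

/-- The angular integral. -/
noncomputable def flowG (r s : ℝ) : ℝ := ∫ θ in (0 : ℝ)..π, flowF r s θ

lemma continuous_flowF : Continuous (fun p : ℝ × ℝ × ℝ => flowF p.1 p.2.1 p.2.2) := by
  unfold flowF
  fun_prop

lemma continuous_flowF_comp {X : Type*} [TopologicalSpace X] {a b c : X → ℝ}
    (ha : Continuous a) (hb : Continuous b) (hc : Continuous c) :
    Continuous (fun x => flowF (a x) (b x) (c x)) :=
  continuous_flowF.comp (ha.prodMk (hb.prodMk hc))

lemma continuous_flowG : Continuous (fun p : ℝ × ℝ => flowG p.1 p.2) := by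
  unfold flowG
  apply intervalIntegral.continuous_parametric_intervalIntegral_of_continuous'
  exact continuous_flowF_comp (a := fun q : (ℝ × ℝ) × ℝ => q.1.1)
    (b := fun q : (ℝ × ℝ) × ℝ => q.1.2) (c := fun q : (ℝ × ℝ) × ℝ => q.2)
    (by fun_prop) (by fun_prop) (by fun_prop)

lemma continuous_flowG_comp {X : Type*} [TopologicalSpace X] {a b : X → ℝ}
    (ha : Continuous a) (hb : Continuous b) :
    Continuous (fun x => flowG (a x) (b x)) :=
  continuous_flowG.comp (ha.prodMk hb)

lemma swap_cont {F : ℝ → ℝ → ℝ} (hF : Continuous F.uncurry) (a b c d : ℝ) :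
    ∫ x in a..b, ∫ y in c..d, F x y = ∫ y in c..d, ∫ x in a..b, F x y := by
  apply MeasureTheory.intervalIntegral_intervalIntegral_swap
  have h : IntegrableOn F.uncurry (Set.uIcc a b ×ˢ Set.uIcc c d) :=
    hF.continuousOn.integrableOn_compact (isCompact_uIcc.prod isCompact_uIcc)
  exact h.mono_set (Set.prod_mono Set.uIoc_subset_uIcc Set.uIoc_subset_uIcc)

lemma meanFlow_eq (n : ℝ) :
    meanFlow n = ∫ s in (0 : ℝ)..n, ∫ r in (0 : ℝ)..n, flowG r s := by
  have h0 : meanFlow n = ∫ θ in (0 : ℝ)..π, ∫ s in (0 : ℝ)..n, ∫ r in (0 : ℝ)..n, flowF r s θ := rfl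
  rw [h0, swap_cont]
  · congr 1
    ext s
    rw [swap_cont]
    · rfl
    · exact continuous_flowF_comp (a := fun q : ℝ × ℝ => q.2)
        (b := fun q : ℝ × ℝ => s) (c := fun q : ℝ × ℝ => q.1)
        (by fun_prop) (by fun_prop) (by fun_prop)
  · apply intervalIntegral.continuous_parametric_intervalIntegral_of_continuous'
    exact continuous_flowF_comp (a := fun q : (ℝ × ℝ) × ℝ => q.2)
      (b := fun q : (ℝ × ℝ) × ℝ => q.1.2) (c := fun q : (ℝ × ℝ) × ℝ => q.1.1)
      (by fun_prop) (by fun_prop) (by fun_prop)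

lemma meanFlow_scale {n : ℝ} (hn : 0 < n) :
    meanFlow n / n ^ 3 = ∫ y in (0 : ℝ)..1, ∫ x in (0 : ℝ)..1, flowG (n * x) (n * y) / n := by
  rw [meanFlow_eq]
  have h1 : ∀ s, ∫ r in (0 : ℝ)..n, flowG r s = n * ∫ x in (0 : ℝ)..1, flowG (n * x) s := by
    intro s
    rw [intervalIntegral.mul_integral_comp_mul_left (f := fun r => flowG r s)]
    simp
  have h2 : ∫ s in (0 : ℝ)..n, ∫ r in (0 : ℝ)..n, flowG r s =
      n * ∫ y in (0 : ℝ)..1, ∫ r in (0 : ℝ)..n, flowG r (n * y) := by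
    rw [intervalIntegral.mul_integral_comp_mul_left
      (f := fun s => ∫ r in (0 : ℝ)..n, flowG r s)]
    simp
  rw [h2]
  simp_rw [h1, intervalIntegral.integral_div, intervalIntegral.integral_const_mul]
  field_simp

/-- Exponential bound. -/
lemma exp_bd {r s θ : ℝ} (hr : 0 < r) (hs : 0 < s) (h0 : 0 ≤ θ) (h1 : θ ≤ π) :
    Real.exp (-(1 / 2) * (r + s - Real.sqrt (r ^ 2 + s ^ 2 + 2 * r * s * Real.cos θ))) ≤
      Real.exp (-(r * s / (π ^ 2 * (r + s))) * θ ^ 2) := by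
  apply Real.exp_le_exp.2
  have hc := Real.cos_le_one_sub_mul_cos_sq (x := θ) (by rw [abs_of_nonneg h0]; exact h1)
  have hpi := Real.pi_pos
  have hrs : 0 < r * s := mul_pos hr hs
  set w := 2 / π ^ 2 * θ ^ 2 with hw
  have hw0 : 0 ≤ w := by positivity
  have hw2 : w ≤ 2 := by linarith [Real.neg_one_le_cos θ]
  set t := r * s * w / (r + s) with ht
  have ht1 : t * (r + s) = r * s * w := by rw [ht]; field_simp
  have ht0 : 0 ≤ t := by positivity
  have ht2 : t ≤ r + s := by
    rw [ht, div_le_iff₀ (by positivity)]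
    nlinarith [sq_nonneg r, sq_nonneg s]
  have hD : Real.sqrt (r ^ 2 + s ^ 2 + 2 * r * s * Real.cos θ) ≤ r + s - t := by
    rw [Real.sqrt_le_left (by linarith)]
    nlinarith [mul_le_mul_of_nonneg_left hc hrs.le, sq_nonneg t]
  have e : (r * s / (π ^ 2 * (r + s))) * θ ^ 2 = t / 2 := by
    rw [ht, hw]; field_simp
  rw [neg_mul (r * s / (π ^ 2 * (r + s))), e]
  linarith

lemma int_one {a : ℝ} (ha : 0 < a) :
    ∫ θ in (0 : ℝ)..π, θ * Real.exp (-a * θ ^ 2) ≤ 1 / (2 * a) := by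
  have : ∫ θ in (0 : ℝ)..π, θ * Real.exp (-a * θ ^ 2) =
      (-(1 / (2 * a)) * Real.exp (-a * π ^ 2)) - (-(1 / (2 * a)) * Real.exp (-a * 0 ^ 2)) := by
    apply intervalIntegral.integral_eq_sub_of_hasDerivAt
      (f := fun θ => -(1 / (2 * a)) * Real.exp (-a * θ ^ 2))
    · intro x _
      have h := ((((hasDerivAt_id x).pow 2).const_mul (-a)).exp).const_mul (-(1 / (2 * a)))
      refine h.congr_deriv ?_
      simp
      field_simp
    · apply Continuous.intervalIntegrable
      fun_prop
  rw [this]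
  have : 0 < 1 / (2 * a) * Real.exp (-a * π ^ 2) := by positivity
  simp
  simp at this
  linarith

lemma int_three {a : ℝ} (ha : 0 < a) :
    ∫ θ in (0 : ℝ)..π, θ ^ 3 * Real.exp (-a * θ ^ 2) ≤ 1 / (2 * a ^ 2) := by
  have : ∫ θ in (0 : ℝ)..π, θ ^ 3 * Real.exp (-a * θ ^ 2) =
      (-(π ^ 2 / (2 * a) + 1 / (2 * a ^ 2)) * Real.exp (-a * π ^ 2)) -
      (-(0 ^ 2 / (2 * a) + 1 / (2 * a ^ 2)) * Real.exp (-a * 0 ^ 2)) := by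
    apply intervalIntegral.integral_eq_sub_of_hasDerivAt
      (f := fun θ => -(θ ^ 2 / (2 * a) + 1 / (2 * a ^ 2)) * Real.exp (-a * θ ^ 2))
    · intro x _
      have h := (((((hasDerivAt_id x).pow 2).div_const (2 * a)).add_const (1 / (2 * a ^ 2))).neg).mul
        ((((hasDerivAt_id x).pow 2).const_mul (-a)).exp)
      refine h.congr_deriv ?_
      simp
      field_simp
      ring
    · apply Continuous.intervalIntegrable
      fun_prop
  rw [this]
  have : 0 < (π ^ 2 / (2 * a) + 1 / (2 * a ^ 2)) * Real.exp (-a * π ^ 2) := by positivity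
  have h2 : (0 : ℝ) ^ 2 / (2 * a) + 1 / (2 * a ^ 2) = 1 / (2 * a ^ 2) := by simp
  have h3 : Real.exp (-a * 0 ^ 2) = 1 := by simp
  rw [h2, h3]
  linarith

lemma flowG_nonneg {r s : ℝ} (hr : 0 < r) (hs : 0 < s) : 0 ≤ flowG r s := by
  apply intervalIntegral.integral_nonneg Real.pi_pos.le
  intro θ hθ
  have := hθ.1
  unfold flowF
  positivity

lemma flowG_le {r s : ℝ} (hr : 0 < r) (hs : 0 < s) : flowG r s ≤ π ^ 2 / 2 * (r + s) := by
  have ha : 0 < r * s / (π ^ 2 * (r + s)) := by positivity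
  have h1 : flowG r s ≤
      ∫ θ in (0 : ℝ)..π, (r * s) * (θ * Real.exp (-(r * s / (π ^ 2 * (r + s))) * θ ^ 2)) := by
    apply intervalIntegral.integral_mono_on Real.pi_pos.le
    · exact (continuous_flowF_comp continuous_const continuous_const continuous_id).intervalIntegrable _ _
    · apply Continuous.intervalIntegrable
      fun_prop
    · intro θ hθ
      have h := exp_bd hr hs hθ.1 hθ.2
      have h0 := hθ.1
      have := mul_le_mul_of_nonneg_right h (by positivity : 0 ≤ r * s * θ)
      unfold flowF
      linarith
  rw [intervalIntegral.integral_const_mul] at h1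
  have h2 := mul_le_mul_of_nonneg_left (int_one ha) (mul_pos hr hs).le
  have h3 : r * s * (1 / (2 * (r * s / (π ^ 2 * (r + s))))) = π ^ 2 / 2 * (r + s) := by
    field_simp
  linarith

/-- The sine version. -/
noncomputable def flowA (r s : ℝ) : ℝ := ∫ θ in (0 : ℝ)..π,
  Real.exp (-(1 / 2) * (r + s - Real.sqrt (r ^ 2 + s ^ 2 + 2 * r * s * Real.cos θ)))
    * (r * s * Real.sin θ)

lemma flowA_eq {r s : ℝ} (hr : 0 < r) (hs : 0 < s) :
    flowA r s = 2 * (r + s) - 4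
      - (2 * |r - s| - 4) * Real.exp (-(1 / 2) * (r + s - |r - s|)) := by
  set D : ℝ → ℝ := fun θ => Real.sqrt (r ^ 2 + s ^ 2 + 2 * r * s * Real.cos θ) with hD
  have hDc : Continuous D := by rw [hD]; fun_prop
  have key : flowA r s =
      (-((2 * D π - 4) * Real.exp (-(1 / 2) * (r + s - D π)))) -
      (-((2 * D 0 - 4) * Real.exp (-(1 / 2) * (r + s - D 0)))) := by
    unfold flowA
    apply intervalIntegral.integral_eq_sub_of_hasDerivAt_of_le Real.pi_pos.le
      (f := fun θ => -((2 * D θ - 4) * Real.exp (-(1 / 2) * (r + s - D θ))))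
    · apply Continuous.continuousOn
      fun_prop
    · intro x hx
      have hcos : -1 < Real.cos x := by
        rw [← Real.cos_pi]
        exact Real.cos_lt_cos_of_nonneg_of_le_pi hx.1.le le_rfl hx.2
      have hpos : 0 < r ^ 2 + s ^ 2 + 2 * r * s * Real.cos x := by
        nlinarith [mul_pos (mul_pos hr hs) (by linarith : 0 < Real.cos x + 1), sq_nonneg (r - s)]
      have hDpos : 0 < D x := Real.sqrt_pos.2 hpos
      have hd : HasDerivAt D ((2 * r * s * (-Real.sin x)) / (2 * D x)) x :=
        (((Real.hasDerivAt_cos x).const_mul (2 * r * s)).const_add (r ^ 2 + s ^ 2)).sqrt hpos.ne'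
      have h := ((((hd.const_mul 2).sub_const 4)).mul
        (((hd.const_sub (r + s)).const_mul (-(1 / 2))).exp)).neg
      refine h.congr_deriv ?_
      change _ = Real.exp (-(1 / 2) * (r + s - D x)) * _
      field_simp
      ring
    · apply Continuous.intervalIntegrable
      fun_prop
  have h0 : D 0 = r + s := by
    rw [hD]
    simp only [Real.cos_zero]
    rw [show r ^ 2 + s ^ 2 + 2 * r * s * 1 = (r + s) ^ 2 by ring]
    exact Real.sqrt_sq (by positivity)
  have hp : D π = |r - s| := by
    rw [hD]
    simp only [Real.cos_pi]
    rw [show r ^ 2 + s ^ 2 + 2 * r * s * (-1) = (r - s) ^ 2 by ring]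
    exact Real.sqrt_sq_eq_abs _
  rw [key, h0, hp]
  simp
  ring

lemma flowA_le_flowG {r s : ℝ} (hr : 0 < r) (hs : 0 < s) : flowA r s ≤ flowG r s := by
  apply intervalIntegral.integral_mono_on Real.pi_pos.le
  · apply Continuous.intervalIntegrable
    fun_prop
  · exact (continuous_flowF_comp continuous_const continuous_const continuous_id).intervalIntegrable _ _
  · intro θ hθ
    have h := Real.sin_le hθ.1
    unfold flowF
    set E := Real.exp (-(1 / 2) * (r + s - Real.sqrt (r ^ 2 + s ^ 2 + 2 * r * s * Real.cos θ)))
    have hE : 0 ≤ E * (r * s) := by positivity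
    have h5 := mul_le_mul_of_nonneg_left h hE
    linarith

lemma flowG_le_flowA {r s : ℝ} (hr : 0 < r) (hs : 0 < s) :
    flowG r s ≤ flowA r s + π ^ 4 / 2 * ((r + s) ^ 2 / (r * s)) := by
  have ha : 0 < r * s / (π ^ 2 * (r + s)) := by positivity
  have h1 : flowG r s ≤
      ∫ θ in (0 : ℝ)..π,
        (Real.exp (-(1 / 2) * (r + s - Real.sqrt (r ^ 2 + s ^ 2 + 2 * r * s * Real.cos θ)))
          * (r * s * Real.sin θ) +
        (r * s) * (θ ^ 3 * Real.exp (-(r * s / (π ^ 2 * (r + s))) * θ ^ 2))) := by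
    apply intervalIntegral.integral_mono_on Real.pi_pos.le
    · exact (continuous_flowF_comp continuous_const continuous_const continuous_id).intervalIntegrable _ _
    · apply Continuous.intervalIntegrable
      fun_prop
    · intro θ hθ
      have h := exp_bd hr hs hθ.1 hθ.2
      have h0 := hθ.1
      have h3 := mul_le_mul_of_nonneg_right h (by positivity : 0 ≤ r * s * θ ^ 3)
      have h4 : θ ≤ Real.sin θ + θ ^ 3 := by
        rcases h0.eq_or_lt with h | h
        · simp [← h]
        · have := Real.sin_gt_sub_cube h
          have : 0 < θ ^ 3 := by positivity
          linarith
      unfold flowF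
      set E := Real.exp (-(1 / 2) * (r + s - Real.sqrt (r ^ 2 + s ^ 2 + 2 * r * s * Real.cos θ)))
      have hE : 0 ≤ E * (r * s) := by positivity
      have h5 := mul_le_mul_of_nonneg_left h4 hE
      linarith
  rw [intervalIntegral.integral_add, intervalIntegral.integral_const_mul] at h1
  · have h2 := mul_le_mul_of_nonneg_left (int_three ha) (mul_pos hr hs).le
    have h3 : r * s * (1 / (2 * (r * s / (π ^ 2 * (r + s))) ^ 2)) =
        π ^ 4 / 2 * ((r + s) ^ 2 / (r * s)) := by
      field_simp
    unfold flowA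
    linarith
  · apply Continuous.intervalIntegrable
    fun_prop
  · apply Continuous.intervalIntegrable
    fun_prop

lemma flowA_lim {x y : ℝ} (hx : 0 < x) (hy : 0 < y) :
    Tendsto (fun n : ℝ => flowA (n * x) (n * y) / n) atTop (nhds (2 * (x + y))) := by
  have hm : 0 < x + y - |x - y| := by
    rcases abs_cases (x - y) with h | h <;> linarith
  have he : Tendsto (fun n : ℝ => Real.exp (-(1 / 2) * (n * (x + y - |x - y|)))) atTop (nhds 0) := by
    apply Real.tendsto_exp_atBot.comp
    apply Tendsto.const_mul_atTop_of_neg (by norm_num)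
    exact tendsto_id.atTop_mul_const hm
  have hi : Tendsto (fun n : ℝ => n⁻¹) atTop (nhds 0) := tendsto_inv_atTop_zero
  have := (((tendsto_const_nhds (x := 2 * (x + y))).sub (hi.const_mul 4))).sub
    (((tendsto_const_nhds (x := 2 * |x - y|)).sub (hi.const_mul 4)).mul he)
  have h2 : 2 * (x + y) - 4 * 0 - (2 * |x - y| - 4 * 0) * 0 = 2 * (x + y) := by ring
  rw [h2] at this
  refine this.congr' ?_
  filter_upwards [eventually_gt_atTop 0] with n hn
  rw [flowA_eq (by positivity) (by positivity)]
  have : |n * x - n * y| = n * |x - y| := by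
    rw [← mul_sub, abs_mul, abs_of_pos hn]
  rw [this, show n * x + n * y - n * |x - y| = n * (x + y - |x - y|) by ring]
  field_simp

lemma flowG_lim {x y : ℝ} (hx : 0 < x) (hy : 0 < y) :
    Tendsto (fun n : ℝ => flowG (n * x) (n * y) / n) atTop (nhds (2 * (x + y))) := by
  have hi : Tendsto (fun n : ℝ => n⁻¹) atTop (nhds 0) := tendsto_inv_atTop_zero
  have hu := (flowA_lim hx hy).add (hi.const_mul (π ^ 4 / 2 * ((x + y) ^ 2 / (x * y))))
  rw [mul_zero, add_zero] at hu
  refine tendsto_of_tendsto_of_tendsto_of_le_of_le' (flowA_lim hx hy) hu ?_ ?_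
  · filter_upwards [eventually_gt_atTop 0] with n hn
    have := flowA_le_flowG (mul_pos hn hx) (mul_pos hn hy)
    gcongr
  · filter_upwards [eventually_gt_atTop 0] with n hn
    have := flowG_le_flowA (mul_pos hn hx) (mul_pos hn hy)
    rw [div_le_iff₀ hn]
    refine this.trans (le_of_eq ?_)
    field_simp

lemma flowG_bd {n x y : ℝ} (hn : 0 < n) (hx : x ∈ Set.Ioc (0 : ℝ) 1) (hy : y ∈ Set.Ioc (0 : ℝ) 1) :
    ‖flowG (n * x) (n * y) / n‖ ≤ π ^ 2 := by
  have hx' := mul_pos hn hx.1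
  have hy' := mul_pos hn hy.1
  rw [Real.norm_of_nonneg (div_nonneg (flowG_nonneg hx' hy') hn.le), div_le_iff₀ hn]
  refine (flowG_le hx' hy').trans ?_
  have : n * x + n * y ≤ 2 * n := by nlinarith [hx.2, hy.2]
  have := mul_le_mul_of_nonneg_left this (by positivity : 0 ≤ π ^ 2 / 2)
  linarith

lemma inner_lim {y : ℝ} (hy : y ∈ Set.Ioc (0 : ℝ) 1) :
    Tendsto (fun n : ℝ => ∫ x in (0 : ℝ)..1, flowG (n * x) (n * y) / n) atTop
      (nhds (∫ x in (0 : ℝ)..1, 2 * (x + y))) := by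
  apply intervalIntegral.tendsto_integral_filter_of_dominated_convergence (fun _ => π ^ 2)
  · filter_upwards with n
    exact ((continuous_flowG_comp (by fun_prop) (by fun_prop)).div_const n).aestronglyMeasurable
  · filter_upwards [eventually_gt_atTop 0] with n hn
    filter_upwards with x hx
    rw [Set.uIoc_of_le zero_le_one] at hx
    exact flowG_bd hn hx hy
  · exact intervalIntegrable_const
  · filter_upwards with x hx
    rw [Set.uIoc_of_le zero_le_one] at hx
    exact flowG_lim hx.1 hy.1

lemma outer_lim :
    Tendsto (fun n : ℝ => ∫ y in (0 : ℝ)..1, ∫ x in (0 : ℝ)..1, flowG (n * x) (n * y) / n) atTop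
      (nhds (∫ y in (0 : ℝ)..1, ∫ x in (0 : ℝ)..1, 2 * (x + y))) := by
  apply intervalIntegral.tendsto_integral_filter_of_dominated_convergence (fun _ => π ^ 2)
  · filter_upwards with n
    apply Continuous.aestronglyMeasurable
    apply intervalIntegral.continuous_parametric_intervalIntegral_of_continuous'
    exact (continuous_flowG_comp (a := fun q : ℝ × ℝ => n * q.2)
      (b := fun q : ℝ × ℝ => n * q.1) (by fun_prop) (by fun_prop)).div_const n
  · filter_upwards [eventually_gt_atTop 0] with n hn
    filter_upwards with y hy
    rw [Set.uIoc_of_le zero_le_one] at hy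
    have := intervalIntegral.norm_integral_le_of_norm_le_const (a := 0) (b := 1) (C := π ^ 2)
      (f := fun x => flowG (n * x) (n * y) / n) (by
        intro x hx
        rw [Set.uIoc_of_le zero_le_one] at hx
        exact flowG_bd hn hx hy)
    simpa using this
  · exact intervalIntegrable_const
  · filter_upwards with y hy
    rw [Set.uIoc_of_le zero_le_one] at hy
    exact inner_lim hy

lemma final_val : (∫ y in (0 : ℝ)..1, ∫ x in (0 : ℝ)..1, 2 * (x + y)) = 2 := by
  have h : ∀ y : ℝ, ∫ x in (0 : ℝ)..1, 2 * (x + y) = 1 + 2 * y := by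
    intro y
    rw [intervalIntegral.integral_const_mul, intervalIntegral.integral_add
      (by apply Continuous.intervalIntegrable; fun_prop) intervalIntegrable_const]
    simp
    ring
  simp_rw [h]
  rw [intervalIntegral.integral_add intervalIntegrable_const
      (by apply Continuous.intervalIntegrable; fun_prop), intervalIntegral.integral_const_mul]
  simp
  norm_num

theorem mean_central_flow_asymptotic :
    Tendsto (fun n : ℝ => meanFlow n / n ^ 3) atTop (nhds 2) := by
  have h := outer_lim
  rw [final_val] at h
  refine h.congr' ?_
  filter_upwards [eventually_gt_atTop 0] with n hn
  exact (meanFlow_scale hn).symm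
end

section
/- The integral ∫₀¹ ∫₀¹ ∫₀^∞ (a + u)·(1/a + 1/u)·t·exp(−(t²/4)·(1/a + 1/u)) dt da du equals 2. -/
open Real MeasureTheory

theorem inner_aux (b : ℝ) (hb : 0 < b) :
    ∫ t in Set.Ioi (0 : ℝ), t * Real.exp (-b * t ^ 2) = 1 / (2 * b) := by
  have h := integral_rpow_mul_exp_neg_mul_rpow (p := 2) (q := 1) (b := b)
    (by norm_num) (by norm_num) hb
  have e1 : (-((1:ℝ) + 1) / 2) = -1 := by norm_num
  have e2 : (((1:ℝ) + 1) / 2) = 1 := by norm_num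
  simp only [e1, e2, Real.rpow_one, Real.rpow_two, Real.Gamma_one, Real.rpow_neg_one] at h
  rw [h]
  field_simp

theorem improper_line_process_mean_flow :
    (∫ u in Set.Ioo (0 : ℝ) 1, ∫ a in Set.Ioo (0 : ℝ) 1, ∫ t in Set.Ioi (0 : ℝ),
        (a + u) * (1 / a + 1 / u) * t *
          Real.exp (-(t ^ 2 / 4) * (1 / a + 1 / u))) = 2 := by
  have key : ∀ u ∈ Set.Ioo (0 : ℝ) 1, (∫ a in Set.Ioo (0 : ℝ) 1, ∫ t in Set.Ioi (0 : ℝ),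
        (a + u) * (1 / a + 1 / u) * t *
          Real.exp (-(t ^ 2 / 4) * (1 / a + 1 / u))) = 1 + 2 * u := by
    intro u hu
    have h1 : ∀ a ∈ Set.Ioo (0 : ℝ) 1, (∫ t in Set.Ioi (0 : ℝ),
        (a + u) * (1 / a + 1 / u) * t *
          Real.exp (-(t ^ 2 / 4) * (1 / a + 1 / u))) = 2 * a + 2 * u := by
      intro a ha
      have ha0 : 0 < a := ha.1
      have hu0 : 0 < u := hu.1
      have hc : 0 < 1 / a + 1 / u := by positivity
      have h := inner_aux ((1 / a + 1 / u) / 4) (by positivity)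
      have e : ∀ t : ℝ, (a + u) * (1 / a + 1 / u) * t *
          Real.exp (-(t ^ 2 / 4) * (1 / a + 1 / u)) = (a + u) * (1 / a + 1 / u) *
          (t * Real.exp (-((1 / a + 1 / u) / 4) * t ^ 2)) := by
        intro t
        rw [mul_assoc _ t]
        congr 3
        ring
      simp_rw [e]
      rw [integral_const_mul, h]
      generalize 1 / a + 1 / u = c at hc
      field_simp
      ring
    rw [setIntegral_congr_fun measurableSet_Ioo h1, ← integral_Ioc_eq_integral_Ioo,
      ← intervalIntegral.integral_of_le zero_le_one, intervalIntegral.integral_add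
        (Continuous.intervalIntegrable (by fun_prop) _ _)
        (Continuous.intervalIntegrable (by fun_prop) _ _),
      intervalIntegral.integral_const_mul, integral_id]
    simp
  rw [setIntegral_congr_fun measurableSet_Ioo key, ← integral_Ioc_eq_integral_Ioo,
      ← intervalIntegral.integral_of_le zero_le_one, intervalIntegral.integral_add
        (Continuous.intervalIntegrable (by fun_prop) _ _)
        (Continuous.intervalIntegrable (by fun_prop) _ _),
      intervalIntegral.integral_const_mul, integral_id]
  norm_num
end

section
/- Let D be the closed unit disk in ℝ². Then the mean Euclidean distance between two independent uniformly distributed random points of D equals 128/(45π); equivalently, ∬_{D×D} ‖p − q‖ dp dq = 128π/45. Equivalently, ∫₀^π ∫₀¹ √(u² + 1 − 2u·cos θ) · u du dθ = 16/9. -/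
open Real MeasureTheory ProbabilityTheory

lemma polar_bdd (f : ℂ → ℝ) (hf : Measurable f) (C R : ℝ) (hR : 0 ≤ R) (hC : ∀ z, |f z| ≤ C)
    (h0 : ∀ z, R < ‖z‖ → f z = 0) :
    ∫ z, f z = ∫ θ in (-π)..π, ∫ r in (0:ℝ)..R,
      r * f ((r:ℂ) * (Real.cos θ + Real.sin θ * Complex.I)) := by
  have hnorm : ∀ p : ℝ × ℝ, ‖((p.1:ℂ) * (Real.cos p.2 + Real.sin p.2 * Complex.I))‖ = |p.1| := by
    intro p
    have := Complex.norm_polarCoord_symm p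
    rwa [Complex.polarCoord_symm_apply] at this
  have hmeas : Measurable fun p : ℝ × ℝ =>
      p.1 * f ((p.1:ℂ) * (Real.cos p.2 + Real.sin p.2 * Complex.I)) := by
    apply measurable_fst.mul
    apply hf.comp
    fun_prop
  have hpi : -π ≤ π := by linarith [pi_pos]
  rw [← Complex.integral_comp_polarCoord_symm]
  simp only [Complex.polarCoord_symm_apply, smul_eq_mul, polarCoord_target]
  rw [setIntegral_eq_of_subset_of_forall_sdiff_eq_zero (s := Set.Ioc 0 R ×ˢ Set.Ioo (-π) π)
    (measurableSet_Ioi.prod measurableSet_Ioo)]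
  · rw [Measure.volume_eq_prod, ← Measure.prod_restrict, integral_prod_symm]
    · rw [intervalIntegral.integral_of_le hpi, integral_Ioc_eq_integral_Ioo]
      simp only [intervalIntegral.integral_of_le hR]
    · have : IsFiniteMeasure ((volume.restrict (Set.Ioc 0 R)).prod
        (volume.restrict (Set.Ioo (-π) π))) := by infer_instance
      refine Integrable.of_bound hmeas.aestronglyMeasurable (R * C) ?_
      rw [Measure.prod_restrict]
      filter_upwards [ae_restrict_mem (measurableSet_Ioc.prod measurableSet_Ioo)] with p hp
      rw [norm_mul, Real.norm_eq_abs, Real.norm_eq_abs]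
      have h1 := hp.1
      apply mul_le_mul _ (hC _) (abs_nonneg _) hR
      rw [abs_of_pos h1.1]; exact h1.2
  · intro p hp
    exact ⟨hp.1.1, hp.2⟩
  · intro p hp
    have h1 : 0 < p.1 := hp.1.1
    have h2 : R < p.1 := by
      by_contra h
      exact hp.2 ⟨⟨h1, not_lt.1 h⟩, hp.1.2⟩
    rw [h0, mul_zero]
    rw [hnorm, abs_of_pos h1]; exact h2

lemma disk_polar (g : ℂ → ℝ) (hg : Continuous g) :
    ∫ z in Metric.closedBall (0:ℂ) 1, g z = ∫ θ in (-π)..π, ∫ r in (0:ℝ)..1,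
      r * g ((r:ℂ) * (Real.cos θ + Real.sin θ * Complex.I)) := by
  rw [← integral_indicator Metric.isClosed_closedBall.measurableSet]
  obtain ⟨C, hC⟩ := (isCompact_closedBall (0:ℂ) 1).exists_bound_of_continuousOn hg.continuousOn
  have hC0 : 0 ≤ C := (norm_nonneg _).trans (hC 0 (by simp))
  rw [polar_bdd _ (hg.measurable.indicator Metric.isClosed_closedBall.measurableSet) C 1 (by simp)]
  · apply intervalIntegral.integral_congr
    intro θ _
    apply intervalIntegral.integral_congr
    intro r hr
    simp only
    rw [Set.indicator_of_mem]
    have := Complex.norm_polarCoord_symm (r, θ)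
    rw [Complex.polarCoord_symm_apply] at this
    rw [mem_closedBall_zero_iff, this]
    rw [Set.uIcc_of_le (by simp)] at hr
    rw [abs_of_nonneg hr.1]; exact hr.2
  · intro z
    by_cases hz : z ∈ Metric.closedBall (0:ℂ) 1
    · rw [Set.indicator_of_mem hz]; exact hC z hz
    · rw [Set.indicator_of_notMem hz]; simpa using hC0
  · intro z hz
    rw [Set.indicator_of_notMem]
    simpa using hz

lemma norm_one_sub_polar (r θ : ℝ) : ‖1 - (r:ℂ) * (Real.cos θ + Real.sin θ * Complex.I)‖
    = √(r ^ 2 + 1 - 2 * r * Real.cos θ) := by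
  rw [Complex.norm_def, Complex.normSq_apply]
  congr 1
  simp [-Complex.ofReal_cos, -Complex.ofReal_sin]
  nlinarith [Real.sin_sq_add_cos_sq θ]

lemma norm_polar' (r θ : ℝ) : ‖(r:ℂ) * (Real.cos θ + Real.sin θ * Complex.I)‖ = |r| := by
  have := Complex.norm_polarCoord_symm (r, θ)
  rwa [Complex.polarCoord_symm_apply] at this

lemma int_cube : ∫ z in Metric.closedBall (0:ℂ) 1, ‖z‖ ^ 3 = 2 * π / 5 := by
  rw [disk_polar _ (by fun_prop)]
  have : ∀ θ : ℝ, ∫ r in (0:ℝ)..1,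
      r * ‖(r:ℂ) * (Real.cos θ + Real.sin θ * Complex.I)‖ ^ 3 = 1 / 5 := by
    intro θ
    have : ∫ r in (0:ℝ)..1,
      r * ‖(r:ℂ) * (Real.cos θ + Real.sin θ * Complex.I)‖ ^ 3 = ∫ r in (0:ℝ)..1, r ^ 4 := by
      apply intervalIntegral.integral_congr
      intro r hr
      rw [Set.uIcc_of_le (by simp)] at hr
      simp only
      rw [norm_polar', abs_of_nonneg hr.1]; ring
    rw [this, integral_pow]; norm_num
  simp only [this]
  rw [intervalIntegral.integral_const, smul_eq_mul]; ring

lemma G_eq_J : ∫ z in Metric.closedBall (0:ℂ) 1, ‖1 - z‖ =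
    2 * ∫ θ in (0 : ℝ)..π, ∫ u in (0 : ℝ)..1, √(u ^ 2 + 1 - 2 * u * Real.cos θ) * u := by
  rw [disk_polar _ (by fun_prop)]
  simp only [norm_one_sub_polar]
  have hc : Continuous fun θ : ℝ => ∫ r in (0:ℝ)..1, r * √(r ^ 2 + 1 - 2 * r * Real.cos θ) := by
    apply intervalIntegral.continuous_parametric_intervalIntegral_of_continuous'
    fun_prop
  rw [← intervalIntegral.integral_add_adjacent_intervals (b := 0)
    (hc.intervalIntegrable _ _) (hc.intervalIntegrable _ _)]
  have h := intervalIntegral.integral_comp_neg (a := 0) (b := π)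
    (fun θ : ℝ => ∫ r in (0:ℝ)..1, r * √(r ^ 2 + 1 - 2 * r * Real.cos θ))
  simp only [Real.cos_neg, neg_zero] at h
  rw [← h, two_mul]
  simp only [mul_comm]

lemma G_one : ∫ z in Metric.closedBall (0:ℂ) 1, ‖1 - z‖ = 32 / 9 := by
  rw [← integral_indicator Metric.isClosed_closedBall.measurableSet,
    ← integral_sub_left_eq_self _ volume (1:ℂ)]
  have hcl : MeasurableSet (Metric.closedBall (1:ℂ) 1) := Metric.isClosed_closedBall.measurableSet
  have e : ∀ x : ℂ, (Metric.closedBall (0:ℂ) 1).indicator (fun z => ‖1 - z‖) (1 - x)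
      = (Metric.closedBall (1:ℂ) 1).indicator (fun z => ‖z‖) x := by
    intro x
    simp only [Set.indicator, Metric.mem_closedBall, dist_eq_norm, sub_zero, sub_sub_cancel]
    rw [norm_sub_rev]
  simp only [e]
  have hle : ∀ x ∈ Metric.closedBall (1:ℂ) 1, ‖x‖ ≤ 2 := by
    intro x hx
    rw [Metric.mem_closedBall, dist_eq_norm] at hx
    calc ‖x‖ = ‖(x - 1) + 1‖ := by simp
      _ ≤ ‖x - 1‖ + ‖(1:ℂ)‖ := norm_add_le _ _
      _ ≤ 2 := by rw [norm_one]; linarith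
  rw [polar_bdd _ (continuous_norm.measurable.indicator hcl) 2 2 (by simp)]
  rotate_left
  · intro z
    by_cases hz : z ∈ Metric.closedBall (1:ℂ) 1
    · rw [Set.indicator_of_mem hz, abs_of_nonneg (norm_nonneg _)]; exact hle z hz
    · rw [Set.indicator_of_notMem hz]; simp
  · intro z hz
    rw [Set.indicator_of_notMem]
    intro h; linarith [hle z h]
  have key : ∀ θ : ℝ, (∫ r in (0:ℝ)..2, r * (Metric.closedBall (1:ℂ) 1).indicator (fun z => ‖z‖)
      ((r:ℂ) * (Real.cos θ + Real.sin θ * Complex.I))) = (2 * max (Real.cos θ) 0) ^ 3 / 3 := by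
    intro θ
    have hM0 : 0 ≤ 2 * max (Real.cos θ) 0 := by positivity
    have hM2 : 2 * max (Real.cos θ) 0 ≤ 2 := by
      have : max (Real.cos θ) 0 ≤ 1 := max_le (Real.cos_le_one θ) (by simp)
      linarith
    have hmem : ∀ r : ℝ, 0 < r → ((r:ℂ) * (Real.cos θ + Real.sin θ * Complex.I) ∈
        Metric.closedBall (1:ℂ) 1 ↔ r ≤ 2 * max (Real.cos θ) 0) := by
      intro r hr
      rw [Metric.mem_closedBall, dist_eq_norm, norm_sub_rev, norm_one_sub_polar,
        Real.sqrt_le_iff, one_pow, and_iff_right zero_le_one]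
      constructor
      · intro h
        have : r * r ≤ r * (2 * Real.cos θ) := by nlinarith
        have := le_of_mul_le_mul_left this hr
        linarith [le_max_left (Real.cos θ) 0]
      · intro h
        rcases le_total (Real.cos θ) 0 with hc | hc
        · rw [max_eq_right hc] at h; linarith
        · rw [max_eq_left hc] at h; nlinarith
    rw [intervalIntegral.integral_of_le (by simp)]
    rw [setIntegral_eq_of_subset_of_forall_sdiff_eq_zero
      (s := Set.Ioc 0 (2 * max (Real.cos θ) 0)) measurableSet_Ioc
      (Set.Ioc_subset_Ioc_right hM2)]
    · rw [setIntegral_congr_fun (g := fun r : ℝ => r ^ 2) measurableSet_Ioc,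
        ← intervalIntegral.integral_of_le hM0, integral_pow]
      · norm_num
      · intro r hr
        simp only
        rw [Set.indicator_of_mem ((hmem r hr.1).2 hr.2), norm_polar', abs_of_pos hr.1]; ring
    · intro r hr
      rw [Set.indicator_of_notMem, mul_zero]
      intro h
      exact hr.2 ⟨hr.1.1, (hmem r hr.1.1).1 h⟩
  simp only [key]
  have hc : Continuous fun θ : ℝ => (2 * max (Real.cos θ) 0) ^ 3 / 3 := by fun_prop
  rw [← intervalIntegral.integral_add_adjacent_intervals (b := -(π/2))
    (hc.intervalIntegrable _ _) (hc.intervalIntegrable _ _),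
    ← intervalIntegral.integral_add_adjacent_intervals (a := -(π/2)) (b := π/2)
    (hc.intervalIntegrable _ _) (hc.intervalIntegrable _ _)]
  have h1 : ∫ θ in (-π)..(-(π/2)), (2 * max (Real.cos θ) 0) ^ 3 / 3 = 0 := by
    rw [intervalIntegral.integral_congr (g := fun _ => (0:ℝ))]
    · simp
    · intro θ hθ
      rw [Set.uIcc_of_le (by linarith [pi_pos])] at hθ
      have : Real.cos θ ≤ 0 := by
        rw [← Real.cos_neg]
        exact Real.cos_nonpos_of_pi_div_two_le_of_le (by linarith [hθ.2])
          (by linarith [hθ.1, pi_pos])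
      simp [max_eq_right this]
  have h2 : ∫ θ in (π/2)..π, (2 * max (Real.cos θ) 0) ^ 3 / 3 = 0 := by
    rw [intervalIntegral.integral_congr (g := fun _ => (0:ℝ))]
    · simp
    · intro θ hθ
      rw [Set.uIcc_of_le (by linarith [pi_pos])] at hθ
      have : Real.cos θ ≤ 0 :=
        Real.cos_nonpos_of_pi_div_two_le_of_le (by linarith [hθ.1])
          (by linarith [hθ.2, pi_pos])
      simp [max_eq_right this]
  have h3 : ∫ θ in (-(π/2))..(π/2), (2 * max (Real.cos θ) 0) ^ 3 / 3 = 32 / 9 := by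
    rw [intervalIntegral.integral_congr (g := fun θ => (8/3) * Real.cos θ ^ 3)]
    · rw [intervalIntegral.integral_const_mul, integral_cos_pow_three]
      simp; norm_num
    · intro θ hθ
      rw [Set.uIcc_of_le (by linarith [pi_pos])] at hθ
      have : 0 ≤ Real.cos θ := Real.cos_nonneg_of_mem_Icc ⟨hθ.1, hθ.2⟩
      simp only [max_eq_left this]; ring
  rw [h1, h2, h3]; norm_num

/-- scaling and rotation -/
lemma G_scale (p : ℂ) : ∫ z in Metric.closedBall (0:ℂ) ‖p‖, ‖p - z‖ = ‖p‖ ^ 3 * (32 / 9) := by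
  rcases eq_or_ne p 0 with rfl | hp
  · simp
  have hp' : 0 < ‖p‖ := norm_pos_iff.2 hp
  have hs := Measure.setIntegral_comp_smul_of_pos (volume : Measure ℂ) (fun z => ‖p - z‖)
    (Metric.closedBall (0:ℂ) 1) hp'
  rw [smul_unitClosedBall_of_nonneg hp'.le, Complex.finrank_real_complex, smul_eq_mul] at hs
  let c : Circle := ⟨p / ‖p‖, by simp [Submonoid.unitSphere, hp]⟩
  have hr := (rotation c).measurePreserving.setIntegral_preimage_emb
    (rotation c).toHomeomorph.measurableEmbedding (fun z => ‖p - ‖p‖ • z‖) (Metric.closedBall (0:ℂ) 1)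
  have hpre : rotation c ⁻¹' (Metric.closedBall (0:ℂ) 1) = Metric.closedBall (0:ℂ) 1 := by
    ext z
    rw [Set.mem_preimage, mem_closedBall_zero_iff, mem_closedBall_zero_iff,
      LinearIsometryEquiv.norm_map]
  rw [hpre] at hr
  have hfun : ∀ z : ℂ, ‖p - ‖p‖ • rotation c z‖ = ‖p‖ * ‖1 - z‖ := by
    intro z
    rw [← norm_mul, rotation_apply, Complex.real_smul]
    congr 1
    have : (c : ℂ) = p / ‖p‖ := rfl
    rw [this]
    have : (‖p‖:ℂ) ≠ 0 := by exact_mod_cast hp'.ne'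
    field_simp
  simp only [hfun] at hr
  rw [integral_const_mul, G_one] at hr
  rw [← hr] at hs
  field_simp at hs ⊢
  linarith

lemma main_C : ∫ p in Metric.closedBall (0:ℂ) 1, ∫ q in Metric.closedBall (0:ℂ) 1, dist p q
    = 128 * π / 45 := by
  set D := Metric.closedBall (0:ℂ) 1 with hD
  have hDm : MeasurableSet D := Metric.isClosed_closedBall.measurableSet
  have : IsFiniteMeasure (volume.restrict D) :=
    ⟨by rw [Measure.restrict_apply_univ]; exact measure_closedBall_lt_top⟩
  let S : Set (ℂ × ℂ) := {x | ‖x.2‖ ≤ ‖x.1‖}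
  have hS : MeasurableSet S := measurableSet_le (by fun_prop) (by fun_prop)
  let f : ℂ × ℂ → ℝ := fun x => dist x.1 x.2
  have hf : Measurable f := by fun_prop
  have hfi : Integrable f ((volume.restrict D).prod (volume.restrict D)) := by
    refine Integrable.of_bound hf.aestronglyMeasurable 2 ?_
    rw [Measure.prod_restrict]
    filter_upwards [ae_restrict_mem (hDm.prod hDm)] with x hx
    have h1 : ‖x.1‖ ≤ 1 := by simpa [hD] using hx.1
    have h2 : ‖x.2‖ ≤ 1 := by simpa [hD] using hx.2
    rw [Real.norm_eq_abs, abs_of_nonneg dist_nonneg]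
    change dist x.1 x.2 ≤ 2
    rw [dist_eq_norm]
    linarith [norm_sub_le x.1 x.2]
  have h1 : ∫ p in D, ∫ q in D, S.indicator f (p, q) = 64 * π / 45 := by
    have : ∀ p ∈ D, ∫ q in D, S.indicator f (p, q) = ‖p‖ ^ 3 * (32 / 9) := by
      intro p hp
      have hp : ‖p‖ ≤ 1 := by simpa [hD] using hp
      have e : ∀ q, S.indicator f (p, q) = (Metric.closedBall (0:ℂ) ‖p‖).indicator (fun q => ‖p - q‖) q := by
        intro q
        simp [Set.indicator, S, f, dist_eq_norm]
      simp only [e]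
      rw [setIntegral_indicator Metric.isClosed_closedBall.measurableSet,
        Set.inter_eq_right.2 (Metric.closedBall_subset_closedBall hp), G_scale]
    rw [setIntegral_congr_fun hDm this, integral_mul_const, int_cube]; ring
  have h2 : ∫ p in D, ∫ q in D, Sᶜ.indicator f (p, q) = 64 * π / 45 := by
    rw [integral_integral_swap (f := fun p q => Sᶜ.indicator f (p, q))
      (by exact hfi.indicator hS.compl)]
    have : ∀ p ∈ D, ∫ q in D, Sᶜ.indicator f (q, p) = ‖p‖ ^ 3 * (32 / 9) := by
      intro p hp
      have hp : ‖p‖ ≤ 1 := by simpa [hD] using hp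
      have e : ∀ q, Sᶜ.indicator f (q, p) = (Metric.ball (0:ℂ) ‖p‖).indicator (fun q => ‖p - q‖) q := by
        intro q
        simp [Set.indicator, S, f, dist_eq_norm, norm_sub_rev q p]
      simp only [e]
      rw [setIntegral_indicator Metric.isOpen_ball.measurableSet,
        Set.inter_eq_right.2 (Metric.ball_subset_closedBall.trans
          (Metric.closedBall_subset_closedBall hp)), ← G_scale]
      apply setIntegral_congr_set
      exact ae_eq_of_subset_of_measure_ge Metric.ball_subset_closedBall
        (by rw [Measure.addHaar_closedBall_eq_addHaar_ball])
        Metric.isOpen_ball.measurableSet.nullMeasurableSet measure_closedBall_lt_top.ne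
    rw [setIntegral_congr_fun hDm this, integral_mul_const, int_cube]; ring
  have h3 : ∫ p in D, ∫ q in D, f (p, q) = 128 * π / 45 := by
    rw [← integral_prod _ hfi]
    rw [← integral_prod _ (hfi.indicator hS)] at h1
    rw [← integral_prod _ (hfi.indicator hS.compl)] at h2
    have := integral_add (hfi.indicator hS) (hfi.indicator hS.compl)
    rw [h1, h2] at this
    simp only [Set.indicator_self_add_compl_apply] at this
    rw [this]; ring
  exact h3

lemma main_E : (∫ p in Metric.closedBall (0 : EuclideanSpace ℝ (Fin 2)) 1,
        ∫ q in Metric.closedBall (0 : EuclideanSpace ℝ (Fin 2)) 1, dist p q)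
      = 128 * π / 45 := by
  let φ := Complex.orthonormalBasisOneI.repr
  have tr : ∀ g : EuclideanSpace ℝ (Fin 2) → ℝ,
      ∫ z in Metric.closedBall (0 : EuclideanSpace ℝ (Fin 2)) 1, g z
        = ∫ z in Metric.closedBall (0:ℂ) 1, g (φ z) := by
    intro g
    rw [← φ.measurePreserving.setIntegral_preimage_emb φ.toHomeomorph.measurableEmbedding g]
    congr 2
    ext z; simp
  rw [tr, ← main_C]
  simp only [tr, φ.dist_map]

theorem mean_distance_unit_disk :
    (∫ p in Metric.closedBall (0 : EuclideanSpace ℝ (Fin 2)) 1,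
        ∫ q in Metric.closedBall (0 : EuclideanSpace ℝ (Fin 2)) 1, dist p q)
      = 128 * π / 45 ∧
    (∫ p, ∫ q, dist p q
        ∂(volume[|Metric.closedBall (0 : EuclideanSpace ℝ (Fin 2)) 1])
        ∂(volume[|Metric.closedBall (0 : EuclideanSpace ℝ (Fin 2)) 1]))
      = 128 / (45 * π) ∧
    (∫ θ in (0 : ℝ)..π, ∫ u in (0 : ℝ)..1,
        Real.sqrt (u ^ 2 + 1 - 2 * u * Real.cos θ) * u) = 16 / 9 := by
  refine ⟨main_E, ?_, ?_⟩
  · have hv : (volume (Metric.closedBall (0 : EuclideanSpace ℝ (Fin 2)) 1))⁻¹.toReal = π⁻¹ := by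
      rw [EuclideanSpace.volume_closedBall_fin_two]
      simp [pi_pos.le]
    simp only [ProbabilityTheory.cond, integral_smul_measure, hv, smul_eq_mul,
      integral_const_mul, main_E]
    field_simp
  · have := G_eq_J
    rw [G_one] at this
    linarith
end

section
/- For positive integers n, define S(n) = Σ over all quadruples of nonnegative integers (u, v, x, y) with u² + v² ≤ n² and x² + y² ≤ n² of the ratio C(u+v, u)·C(x+y, x)/C(u+v+x+y, u+x), where C(m, k) denotes the binomial coefficient. Then S(n)/n³ → 2 as n → ∞. -/
open Filter

/-- Total flow through the origin between two opposing quadrants of the disk of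
radius `n` in the Manhattan grid city, with geodesics chosen uniformly. -/
noncomputable def gridFlow (n : ℕ) : ℝ :=
  ∑ u ∈ Finset.range (n + 1), ∑ v ∈ Finset.range (n + 1),
    ∑ x ∈ Finset.range (n + 1), ∑ y ∈ Finset.range (n + 1),
      if u ^ 2 + v ^ 2 ≤ n ^ 2 ∧ x ^ 2 + y ^ 2 ≤ n ^ 2 then
        ((u + v).choose u * (x + y).choose x : ℝ) / ((u + v + x + y).choose (u + x))
      else 0

open MeasureTheory Topology

namespace GridFlowAux

/-- Beta integral with natural parameters. -/
lemma beta_nat (b : ℕ) : ∀ a : ℕ,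
    ((a + b + 1).factorial : ℝ) * ∫ t in (0:ℝ)..1, t ^ a * (1 - t) ^ b
      = a.factorial * b.factorial := by
  induction b with
  | zero =>
    intro a
    have h : ((a : ℝ) + 1) ≠ 0 := by positivity
    simp [Nat.factorial_succ]
    field_simp
  | succ b ih =>
    intro a
    have key : ∫ t in (0:ℝ)..1, (((a:ℝ) + 1) * (t ^ a * (1 - t) ^ (b + 1))
        - ((b:ℝ) + 1) * (t ^ (a + 1) * (1 - t) ^ b)) = 0 := by
      have := intervalIntegral.integral_eq_sub_of_hasDerivAt (a := (0:ℝ)) (b := 1)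
        (f := fun t : ℝ => t ^ (a + 1) * (1 - t) ^ (b + 1))
        (f' := fun t : ℝ => ((a:ℝ) + 1) * (t ^ a * (1 - t) ^ (b + 1))
        - ((b:ℝ) + 1) * (t ^ (a + 1) * (1 - t) ^ b)) ?_ ?_
      · rw [this]; simp
      · intro t _
        have h1 := hasDerivAt_pow (a + 1) t
        have h2 := ((hasDerivAt_id t).const_sub 1).pow (b + 1)
        refine HasDerivAt.congr_deriv (h1.mul h2) ?_
        simp
        ring
      · apply Continuous.intervalIntegrable; fun_prop
    rw [intervalIntegral.integral_sub, intervalIntegral.integral_const_mul,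
      intervalIntegral.integral_const_mul] at key
    · have h := ih (a + 1)
      have e : a + 1 + b + 1 = a + (b + 1) + 1 := by ring
      rw [e] at h
      have ha : ((a : ℝ) + 1) ≠ 0 := by positivity
      rw [Nat.factorial_succ a] at h
      rw [Nat.factorial_succ b]
      push_cast at h ⊢
      apply mul_left_cancel₀ ha
      linear_combination ((b:ℝ)+1) * h + ((a + (b + 1) + 1).factorial : ℝ) * key
    · apply Continuous.intervalIntegrable; fun_prop
    · apply Continuous.intervalIntegrable; fun_prop

/-- Bernstein weight. -/
noncomputable def w (t : ℝ) (p : ℕ × ℕ) : ℝ :=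
  ((p.1 + p.2).choose p.1 : ℝ) * (t ^ p.1 * (1 - t) ^ p.2)

lemma w_cont (p : ℕ × ℕ) : Continuous (fun t => w t p) := by unfold w; fun_prop

lemma w_nonneg {t : ℝ} (h0 : 0 ≤ t) (h1 : t ≤ 1) (p : ℕ × ℕ) : 0 ≤ w t p := by
  have : 0 ≤ 1 - t := by linarith
  unfold w; positivity

lemma ratio_eq (u v x y : ℕ) :
    ((u + v).choose u * (x + y).choose x : ℝ) / ((u + v + x + y).choose (u + x))
      = ∫ t in (0:ℝ)..1, ((u + v : ℕ) + (x + y : ℕ) + 1 : ℝ) * (w t (u, v) * w t (x, y)) := by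
  have hint : ∀ t : ℝ, ((u + v : ℕ) + (x + y : ℕ) + 1 : ℝ) * (w t (u, v) * w t (x, y))
      = (((u + v : ℕ) + (x + y : ℕ) + 1 : ℝ) * ((u + v).choose u * (x + y).choose x)) *
        (t ^ (u + x) * (1 - t) ^ (v + y)) := by
    intro t; simp only [w, pow_add]; ring
  simp_rw [hint]
  rw [intervalIntegral.integral_const_mul]
  have hb := beta_nat (v + y) (u + x)
  have hc := Nat.add_choose_mul_factorial_mul_factorial (v + y) (u + x)
  rw [add_comm (v + y) (u + x)] at hc
  have e : u + v + x + y = u + x + (v + y) := by ring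
  rw [e]
  have hpos : (0:ℝ) < ((u + x + (v + y)).choose (u + x) : ℝ) := by
    exact_mod_cast Nat.choose_pos (by omega)
  rw [Nat.factorial_succ] at hb
  have hc' : (((u + x + (v + y)).choose (u + x) : ℝ)) * (u+x).factorial * (v+y).factorial
      = (u + x + (v + y)).factorial := by
    rw [← hc]; push_cast; ring
  have hf : (0:ℝ) < (u + x + (v + y)).factorial := by positivity
  rw [div_eq_iff hpos.ne']
  apply mul_left_cancel₀ hf.ne'
  push_cast at hb ⊢
  linear_combination (-((u + v).choose u * (x + y).choose x : ℝ)) * hc'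
    - ((u + v).choose u * (x + y).choose x : ℝ) * (((u + x + (v + y)).choose (u + x) : ℝ)) * hb

/-- quarter disc -/
def disc (n : ℕ) : Finset (ℕ × ℕ) :=
  (Finset.range (n + 1) ×ˢ Finset.range (n + 1)).filter (fun p => p.1 ^ 2 + p.2 ^ 2 ≤ n ^ 2)

lemma mem_disc {n : ℕ} {p : ℕ × ℕ} : p ∈ disc n ↔ p.1 ^ 2 + p.2 ^ 2 ≤ n ^ 2 := by
  simp only [disc, Finset.mem_filter, Finset.mem_product, Finset.mem_range, and_iff_right_iff_imp]
  intro h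
  constructor <;> · rw [Nat.lt_succ_iff]; nlinarith

noncomputable def G (n m : ℕ) (t : ℝ) : ℝ :=
  ∑ p ∈ Finset.HasAntidiagonal.antidiagonal m, if p.1 ^ 2 + p.2 ^ 2 ≤ n ^ 2 then w t p else 0

noncomputable def A (n : ℕ) (t : ℝ) : ℝ := ∑ m ∈ Finset.range (2 * n + 1), G n m t
noncomputable def D (n : ℕ) (t : ℝ) : ℝ := ∑ m ∈ Finset.range (2 * n + 1), (m : ℝ) * G n m t

lemma sum_disc (n : ℕ) (t : ℝ) (f : ℕ → ℝ) :
    ∑ p ∈ disc n, f (p.1 + p.2) * w t p = ∑ m ∈ Finset.range (2 * n + 1), f m * G n m t := by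
  rw [← Finset.sum_fiberwise_of_maps_to (s := disc n) (t := Finset.range (2 * n + 1))
    (g := fun p => p.1 + p.2)]
  · apply Finset.sum_congr rfl
    intro m _
    rw [G, Finset.mul_sum]
    have : (disc n).filter (fun p => p.1 + p.2 = m)
        = (Finset.HasAntidiagonal.antidiagonal m).filter (fun p => p.1 ^ 2 + p.2 ^ 2 ≤ n ^ 2) := by
      ext p; simp [mem_disc, and_comm]
    rw [this, Finset.sum_filter]
    apply Finset.sum_congr rfl
    intro p hp
    rw [Finset.HasAntidiagonal.mem_antidiagonal] at hp
    rw [hp]; split_ifs <;> simp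
  · intro p hp
    rw [mem_disc] at hp
    rw [Finset.mem_range]
    have h1 : p.1 ≤ n := by nlinarith
    have h2 : p.2 ≤ n := by nlinarith
    omega

lemma gridFlow_eq (n : ℕ) :
    gridFlow n = ∫ t in (0:ℝ)..1, (2 * (A n t * D n t) + A n t ^ 2) := by
  have h1 : gridFlow n = ∑ p ∈ disc n, ∑ q ∈ disc n,
      ∫ t in (0:ℝ)..1, ((p.1 + p.2 : ℕ) + (q.1 + q.2 : ℕ) + 1 : ℝ) * (w t p * w t q) := by
    unfold gridFlow
    simp_rw [disc, Finset.sum_filter, Finset.sum_product]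
    refine Finset.sum_congr rfl fun u _ => Finset.sum_congr rfl fun v _ => ?_
    split_ifs with h
    · refine Finset.sum_congr rfl fun x _ => Finset.sum_congr rfl fun y _ => ?_
      simp only [h, true_and]
      split_ifs
      · exact ratio_eq u v x y
      · rfl
    · simp [h]
  have hc : ∀ p q : ℕ × ℕ, Continuous fun t : ℝ =>
      ((p.1 + p.2 : ℕ) + (q.1 + q.2 : ℕ) + 1 : ℝ) * (w t p * w t q) := by
    intro p q
    exact continuous_const.mul ((w_cont p).mul (w_cont q))
  rw [h1]
  have h2 : ∀ p ∈ disc n, ∑ q ∈ disc n,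
      ∫ t in (0:ℝ)..1, ((p.1 + p.2 : ℕ) + (q.1 + q.2 : ℕ) + 1 : ℝ) * (w t p * w t q)
      = ∫ t in (0:ℝ)..1, ∑ q ∈ disc n,
        ((p.1 + p.2 : ℕ) + (q.1 + q.2 : ℕ) + 1 : ℝ) * (w t p * w t q) := by
    intro p _
    rw [intervalIntegral.integral_finsetSum]
    exact fun q _ => (hc p q).intervalIntegrable _ _
  rw [Finset.sum_congr rfl h2, ← intervalIntegral.integral_finsetSum]
  · congr 1
    ext t
    have hA : A n t = ∑ p ∈ disc n, w t p := by
      have := sum_disc n t (fun _ => 1)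
      simp only [one_mul] at this
      rw [this, A]
    have hD : D n t = ∑ p ∈ disc n, ((p.1 + p.2 : ℕ) : ℝ) * w t p := by
      have := sum_disc n t (fun m => (m : ℝ))
      rw [this, D]
    have e1 : A n t * D n t = ∑ p ∈ disc n, ∑ q ∈ disc n,
        ((q.1 + q.2 : ℕ) : ℝ) * (w t p * w t q) := by
      rw [hA, hD, Finset.sum_mul_sum]
      exact Finset.sum_congr rfl fun _ _ => Finset.sum_congr rfl fun _ _ => by ring
    have e2 : D n t * A n t = ∑ p ∈ disc n, ∑ q ∈ disc n,
        ((p.1 + p.2 : ℕ) : ℝ) * (w t p * w t q) := by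
      rw [hA, hD, Finset.sum_mul_sum]
      exact Finset.sum_congr rfl fun _ _ => Finset.sum_congr rfl fun _ _ => by ring
    have e3 : A n t * A n t = ∑ p ∈ disc n, ∑ q ∈ disc n, w t p * w t q := by
      rw [hA, Finset.sum_mul_sum]
    have e4 : 2 * (A n t * D n t) + A n t ^ 2 = D n t * A n t + A n t * D n t + A n t * A n t := by
      ring
    rw [e4, e1, e2, e3]
    simp_rw [← Finset.sum_add_distrib]
    exact Finset.sum_congr rfl fun _ _ => Finset.sum_congr rfl fun _ _ => by ring
  · intro p _
    exact (continuous_finsetSum _ fun q _ => hc p q).intervalIntegrable _ _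

lemma G_cont (n m : ℕ) : Continuous (G n m) := by
  unfold G
  refine continuous_finsetSum _ fun p _ => ?_
  split_ifs
  · exact w_cont p
  · exact continuous_const

lemma A_cont (n : ℕ) : Continuous (A n) := by
  unfold A; exact continuous_finsetSum _ fun m _ => G_cont n m

lemma D_cont (n : ℕ) : Continuous (D n) := by
  unfold D; exact continuous_finsetSum _ fun m _ => continuous_const.mul (G_cont n m)

lemma sum_w (m : ℕ) (t : ℝ) : ∑ p ∈ Finset.HasAntidiagonal.antidiagonal m, w t p = 1 := by
  rw [Finset.Nat.sum_antidiagonal_eq_sum_range_succ_mk]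
  have := congrArg (Polynomial.eval t) (bernsteinPolynomial.sum ℝ m)
  simp only [Polynomial.eval_finsetSum, bernsteinPolynomial, Polynomial.eval_mul,
    Polynomial.eval_pow, Polynomial.eval_sub, Polynomial.eval_X, Polynomial.eval_one,
    Polynomial.eval_natCast] at this
  rw [← this]
  refine Finset.sum_congr rfl fun k hk => ?_
  have hk : k ≤ m := by simpa [Nat.lt_succ_iff] using hk
  simp only [w]
  rw [Nat.add_sub_cancel' hk]; ring

lemma var_w (m : ℕ) (t : ℝ) :
    ∑ p ∈ Finset.HasAntidiagonal.antidiagonal m, ((p.1 : ℝ) - m * t) ^ 2 * w t p = m * (t * (1 - t)) := by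
  rw [Finset.Nat.sum_antidiagonal_eq_sum_range_succ_mk]
  have := congrArg (Polynomial.eval t) (bernsteinPolynomial.variance ℝ m)
  simp only [Polynomial.eval_finsetSum, bernsteinPolynomial, Polynomial.eval_mul, nsmul_eq_mul,
    Polynomial.eval_pow, Polynomial.eval_sub, Polynomial.eval_X, Polynomial.eval_one,
    Polynomial.eval_natCast] at this
  rw [← mul_assoc, ← this]
  refine Finset.sum_congr rfl fun k hk => ?_
  have hk : k ≤ m := by simpa [Nat.lt_succ_iff] using hk
  simp only [w]
  rw [Nat.add_sub_cancel' hk]; ring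

lemma G_nonneg {t : ℝ} (h0 : 0 ≤ t) (h1 : t ≤ 1) (n m : ℕ) : 0 ≤ G n m t := by
  refine Finset.sum_nonneg fun p _ => ?_
  have := w_nonneg h0 h1 p
  split_ifs <;> simp [this]

lemma G_le {t : ℝ} (h0 : 0 ≤ t) (h1 : t ≤ 1) (n m : ℕ) : G n m t ≤ 1 := by
  rw [← sum_w m t]
  refine Finset.sum_le_sum fun p _ => ?_
  have := w_nonneg h0 h1 p
  split_ifs <;> simp [this]

/-- Norm of the direction `(t, 1 - t)`. -/
noncomputable def r (t : ℝ) : ℝ := √(t ^ 2 + (1 - t) ^ 2)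

lemma r_sq (t : ℝ) : r t ^ 2 = t ^ 2 + (1 - t) ^ 2 := Real.sq_sqrt (by positivity)

lemma r_pos (t : ℝ) : 0 < r t := by
  apply Real.sqrt_pos.2; nlinarith [sq_nonneg (2 * t - 1)]

lemma r_ge (t : ℝ) : 1 / 2 ≤ r t := by
  apply Real.le_sqrt_of_sq_le; nlinarith [sq_nonneg (2 * t - 1)]

lemma r_cont : Continuous r := by unfold r; fun_prop

noncomputable def I (n m : ℕ) (t : ℝ) : ℝ := if (m : ℝ) * r t ≤ n then 1 else 0

/-- Deterministic estimate: if the indicators differ then `|m r - n|` is small. -/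
lemma det_bound (n m : ℕ) (t : ℝ) (p : ℕ × ℕ) (hp : p.1 + p.2 = m)
    (h : ¬ (p.1 ^ 2 + p.2 ^ 2 ≤ n ^ 2 ↔ (m : ℝ) * r t ≤ n)) :
    ((m : ℝ) * r t - n) ^ 2 ≤ 2 * ((p.1 : ℝ) - m * t) ^ 2 := by
  set N : ℝ := √((p.1 : ℝ) ^ 2 + (p.2 : ℝ) ^ 2) with hN
  have hN0 : 0 ≤ N := Real.sqrt_nonneg _
  have hN2 : N ^ 2 = (p.1 : ℝ) ^ 2 + (p.2 : ℝ) ^ 2 := Real.sq_sqrt (by positivity)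
  have hn0 : (0:ℝ) ≤ n := by positivity
  have hr := r_pos t
  have hr2 := r_sq t
  have hiff : p.1 ^ 2 + p.2 ^ 2 ≤ n ^ 2 ↔ N ≤ n := by
    rw [← sq_le_sq₀ hN0 hn0, hN2]; exact_mod_cast Iff.rfl
  rw [hiff] at h
  have hm : (p.1 : ℝ) + p.2 = m := by exact_mod_cast hp
  -- (N - m r)^2 ≤ 2 (p.1 - m t)^2
  have key : (N - m * r t) ^ 2 ≤ 2 * ((p.1 : ℝ) - m * t) ^ 2 := by
    have cs : (p.1 : ℝ) * t + p.2 * (1 - t) ≤ N * r t := by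
      refine (abs_le_of_sq_le_sq' ?_ (by positivity)).2
      rw [mul_pow, hN2, hr2]
      nlinarith [sq_nonneg ((p.1 : ℝ) * (1 - t) - p.2 * t)]
    have hm0 : (0:ℝ) ≤ m := by positivity
    have e : 2 * ((p.1 : ℝ) - m * t) ^ 2
        = N ^ 2 + m ^ 2 * r t ^ 2 - 2 * m * (p.1 * t + p.2 * (1 - t)) := by
      rw [hN2, hr2, ← hm]; ring
    rw [e]
    nlinarith [mul_le_mul_of_nonneg_left cs hm0]
  have hd : (m * r t - n) ^ 2 ≤ (N - m * r t) ^ 2 := by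
    by_cases h1 : N ≤ n
    · have : ¬ ((m : ℝ) * r t ≤ n) := fun h2 => h ⟨fun _ => h2, fun _ => h1⟩
      nlinarith
    · have : (m : ℝ) * r t ≤ n := by
        by_contra h2; exact h ⟨fun h3 => absurd h3 h1, fun h3 => absurd h3 h2⟩
      nlinarith
  linarith

lemma G_sub_le {t : ℝ} (h0 : 0 ≤ t) (h1 : t ≤ 1) (n m : ℕ) :
    |G n m t - I n m t| * ((m : ℝ) * r t - n) ^ 2 ≤ m / 2 := by
  have e : G n m t - I n m t = ∑ p ∈ Finset.HasAntidiagonal.antidiagonal m,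
      ((if p.1 ^ 2 + p.2 ^ 2 ≤ n ^ 2 then 1 else 0) - I n m t) * w t p := by
    simp_rw [sub_mul]
    rw [Finset.sum_sub_distrib, ← Finset.mul_sum, sum_w, mul_one, G]
    simp
  have b : |G n m t - I n m t| * ((m : ℝ) * r t - n) ^ 2 ≤
      ∑ p ∈ Finset.HasAntidiagonal.antidiagonal m, 2 * (((p.1 : ℝ) - m * t) ^ 2 * w t p) := by
    rw [e]
    refine (mul_le_mul_of_nonneg_right (Finset.abs_sum_le_sum_abs _ _) (sq_nonneg _)).trans ?_
    rw [Finset.sum_mul]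
    refine Finset.sum_le_sum fun p hp => ?_
    have hw := w_nonneg h0 h1 p
    rw [abs_mul, abs_of_nonneg hw]
    rw [Finset.HasAntidiagonal.mem_antidiagonal] at hp
    by_cases h : (p.1 ^ 2 + p.2 ^ 2 ≤ n ^ 2 ↔ (m : ℝ) * r t ≤ n)
    · have : ((if p.1 ^ 2 + p.2 ^ 2 ≤ n ^ 2 then 1 else 0) - I n m t) = 0 := by
        unfold I; simp only [h]; simp
      rw [this]; simp; positivity
    · have hd := det_bound n m t p hp h
      have h1 : |(if p.1 ^ 2 + p.2 ^ 2 ≤ n ^ 2 then 1 else 0) - I n m t| ≤ 1 := by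
        unfold I; split_ifs <;> simp
      calc _ ≤ 1 * w t p * ((m : ℝ) * r t - n) ^ 2 := by gcongr
        _ ≤ 1 * w t p * (2 * ((p.1 : ℝ) - m * t) ^ 2) := by gcongr
        _ = _ := by ring
  rw [← Finset.mul_sum, var_w] at b
  have hm0 : (0:ℝ) ≤ m := by positivity
  nlinarith [mul_nonneg hm0 (sq_nonneg (2 * t - 1))]

lemma abs_G_sub_I_le_one {t : ℝ} (h0 : 0 ≤ t) (h1 : t ≤ 1) (n m : ℕ) :
    |G n m t - I n m t| ≤ 1 := by
  have := G_nonneg h0 h1 n m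
  have := G_le h0 h1 n m
  unfold I
  rw [abs_le]; split_ifs <;> constructor <;> linarith

noncomputable def E (n : ℕ) (t : ℝ) : ℝ :=
  ∑ m ∈ Finset.range (2 * n + 1), |G n m t - I n m t|

lemma E_nonneg (n : ℕ) (t : ℝ) : 0 ≤ E n t := Finset.sum_nonneg fun _ _ => abs_nonneg _

lemma count (n : ℕ) (t δ : ℝ) (hδ : 0 < δ) :
    (((Finset.range (2 * n + 1)).filter
      (fun m : ℕ => |(m : ℝ) * r t - n| ≤ δ * n)).card : ℝ) ≤ 4 * δ * n + 1 := by
  have hr := r_pos t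
  have hr' := r_ge t
  have hn0 : (0:ℝ) ≤ n := by positivity
  have hsub : (Finset.range (2 * n + 1)).filter
      (fun m : ℕ => |(m : ℝ) * r t - n| ≤ δ * n) ⊆
      Finset.Icc ⌈(1 - δ) * n / r t⌉₊ ⌊(1 + δ) * n / r t⌋₊ := by
    intro m hm
    rw [Finset.mem_filter, abs_le] at hm
    rw [Finset.mem_Icc, Nat.ceil_le, Nat.le_floor_iff (by positivity), div_le_iff₀ hr,
      le_div_iff₀ hr]
    constructor <;> linarith [hm.2.1, hm.2.2]
  have hc := Finset.card_le_card hsub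
  rw [Nat.card_Icc] at hc
  have hc' : (((Finset.range (2 * n + 1)).filter
      (fun m : ℕ => |(m : ℝ) * r t - n| ≤ δ * n)).card : ℝ) ≤
      ((⌊(1 + δ) * n / r t⌋₊ + 1 - ⌈(1 - δ) * n / r t⌉₊ : ℕ) : ℝ) := by exact_mod_cast hc
  refine hc'.trans ?_
  rcases le_total ⌈(1 - δ) * n / r t⌉₊ (⌊(1 + δ) * n / r t⌋₊ + 1) with h | h
  · rw [Nat.cast_sub h]
    push_cast
    have h1 := Nat.floor_le (a := (1 + δ) * n / r t) (by positivity)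
    have h2 := Nat.le_ceil ((1 - δ) * n / r t)
    have h3 : (1 + δ) * n / r t - (1 - δ) * n / r t = 2 * δ * n / r t := by ring
    have h4 : 2 * δ * n / r t ≤ 4 * δ * n := by
      rw [div_le_iff₀ hr]
      have : 0 ≤ δ * n := by positivity
      nlinarith
    linarith
  · rw [Nat.sub_eq_zero_of_le h]; simp; positivity

lemma E_le {t : ℝ} (h0 : 0 ≤ t) (h1 : t ≤ 1) (n : ℕ) (hn : 0 < n) (δ : ℝ) (hδ : 0 < δ) :
    E n t ≤ 4 * δ * n + (1 + 3 / δ ^ 2) := by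
  have hn' : (1:ℝ) ≤ n := by exact_mod_cast hn
  have hb : ∀ m ∈ Finset.range (2 * n + 1), |G n m t - I n m t| ≤
      (if |(m : ℝ) * r t - n| ≤ δ * n then 1 else 0) + 1 / (δ ^ 2 * n) := by
    intro m hm
    have hm : m ≤ 2 * n := by simpa [Nat.lt_succ_iff] using hm
    have hm' : (m:ℝ) ≤ 2 * n := by exact_mod_cast hm
    split_ifs with h
    · have := abs_G_sub_I_le_one h0 h1 n m
      have : 0 ≤ 1 / (δ ^ 2 * (n:ℝ)) := by positivity
      linarith
    · rw [not_le] at h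
      have hg := G_sub_le h0 h1 n m
      have hsq : (δ * n) ^ 2 ≤ ((m : ℝ) * r t - n) ^ 2 := by
        rw [← sq_abs ((m : ℝ) * r t - n)]
        gcongr
      have : |G n m t - I n m t| * (δ * n) ^ 2 ≤ n := by
        have := mul_le_mul_of_nonneg_left hsq (abs_nonneg (G n m t - I n m t))
        linarith
      rw [zero_add, le_div_iff₀ (by positivity)]
      have hn0 : (0:ℝ) < n := by linarith
      apply le_of_mul_le_mul_right _ hn0
      linarith
  refine (Finset.sum_le_sum hb).trans ?_
  rw [Finset.sum_add_distrib, Finset.sum_boole, Finset.sum_const, Finset.card_range, nsmul_eq_mul]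
  have hcnt := count n t δ hδ
  have : ((2 * n + 1 : ℕ) : ℝ) * (1 / (δ ^ 2 * n)) ≤ 3 / δ ^ 2 := by
    rw [mul_one_div, div_le_div_iff₀ (by positivity) (by positivity)]
    push_cast
    have : 0 < δ ^ 2 := by positivity
    nlinarith
  linarith

lemma E_tendsto {t : ℝ} (h0 : 0 ≤ t) (h1 : t ≤ 1) :
    Tendsto (fun n : ℕ => E n t / n) atTop (𝓝 0) := by
  rw [Metric.tendsto_atTop]
  intro ε hε
  set δ := ε / 8 with hδd
  have hδ : 0 < δ := by positivity
  obtain ⟨N, hN⟩ := exists_nat_gt ((1 + 3 / δ ^ 2) / (ε / 2))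
  refine ⟨N + 1, fun n hn => ?_⟩
  have hn0 : 0 < n := by omega
  have hn' : (0:ℝ) < n := by exact_mod_cast hn0
  have hNn : (N:ℝ) ≤ n := by exact_mod_cast (by omega : N ≤ n)
  rw [Real.dist_eq, sub_zero, abs_of_nonneg (div_nonneg (E_nonneg n t) hn'.le), div_lt_iff₀ hn']
  have := E_le h0 h1 n hn0 δ hδ
  rw [div_lt_iff₀ (by positivity)] at hN
  have : (N:ℝ) * (ε / 2) ≤ n * (ε / 2) := by gcongr
  have h8 : 4 * δ * n = n * (ε / 2) := by rw [hδd]; ring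
  linarith

noncomputable def K (n : ℕ) (t : ℝ) : ℕ := ⌊(r t)⁻¹ * (n : ℝ)⌋₊

lemma sum_I (n : ℕ) (t : ℝ) (f : ℕ → ℝ) :
    ∑ m ∈ Finset.range (2 * n + 1), f m * I n m t = ∑ m ∈ Finset.range (K n t + 1), f m := by
  have hr := r_pos t
  have hr' := r_ge t
  have hiff : ∀ m : ℕ, (m : ℝ) * r t ≤ n ↔ m ≤ K n t := by
    intro m
    rw [K, Nat.le_floor_iff (by positivity), inv_mul_eq_div, le_div_iff₀ hr]
  have : Finset.range (K n t + 1) = (Finset.range (2 * n + 1)).filter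
      (fun m : ℕ => (m : ℝ) * r t ≤ n) := by
    ext m
    rw [Finset.mem_filter, hiff, Finset.mem_range, Finset.mem_range, Nat.lt_succ_iff,
      Nat.lt_succ_iff]
    refine ⟨fun h => ⟨?_, h⟩, fun h => h.2⟩
    have := (hiff m).2 h
    have h2 : (m : ℝ) ≤ 2 * n := by
      have : (0:ℝ) ≤ m := by positivity
      nlinarith
    exact_mod_cast h2
  rw [this, Finset.sum_filter]
  refine Finset.sum_congr rfl fun m _ => ?_
  unfold I; split_ifs <;> simp

lemma A_sub (n : ℕ) (t : ℝ) : |A n t - ((K n t : ℝ) + 1)| ≤ E n t := by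
  have h := sum_I n t (fun _ => 1)
  simp only [one_mul, Finset.sum_const, Finset.card_range, nsmul_eq_mul, mul_one] at h
  push_cast at h
  rw [← h, A, ← Finset.sum_sub_distrib]
  exact Finset.abs_sum_le_sum_abs _ _

lemma D_sub (n : ℕ) (t : ℝ) :
    |D n t - (K n t : ℝ) * ((K n t : ℝ) + 1) / 2| ≤ 2 * n * E n t := by
  have h := sum_I n t (fun m => (m:ℝ))
  have h2 : ∑ m ∈ Finset.range (K n t + 1), (m:ℝ) = (K n t : ℝ) * ((K n t : ℝ) + 1) / 2 := by
    have := Finset.sum_range_id_mul_two (K n t + 1)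
    have : (∑ m ∈ Finset.range (K n t + 1), (m:ℝ)) * 2 = ((K n t : ℝ) + 1) * K n t := by
      rw [Nat.add_sub_cancel] at this
      have := congrArg (Nat.cast (R := ℝ)) this
      push_cast at this
      exact this
    linarith
  rw [← h2, ← h, D, ← Finset.sum_sub_distrib, E, Finset.mul_sum]
  refine (Finset.abs_sum_le_sum_abs _ _).trans (Finset.sum_le_sum fun m hm => ?_)
  have hm : m ≤ 2 * n := by simpa [Nat.lt_succ_iff] using hm
  have hm' : (m:ℝ) ≤ 2 * n := by exact_mod_cast hm
  rw [← mul_sub, abs_mul, Nat.abs_cast]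
  gcongr

lemma K_tendsto (t : ℝ) : Tendsto (fun n : ℕ => (K n t : ℝ) / n) atTop (𝓝 (r t)⁻¹) :=
  (tendsto_nat_floor_mul_div_atTop (inv_nonneg.2 (r_pos t).le)).comp tendsto_natCast_atTop_atTop

lemma A_tendsto {t : ℝ} (h0 : 0 ≤ t) (h1 : t ≤ 1) :
    Tendsto (fun n : ℕ => A n t / n) atTop (𝓝 (r t)⁻¹) := by
  have hK : Tendsto (fun n : ℕ => (K n t : ℝ) / n + 1 / n) atTop (𝓝 ((r t)⁻¹ + 0)) :=
    (K_tendsto t).add tendsto_one_div_atTop_nhds_zero_nat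
  rw [add_zero] at hK
  have hd : Tendsto (fun n : ℕ => A n t / n - ((K n t : ℝ) / n + 1 / n)) atTop (𝓝 0) := by
    refine squeeze_zero_norm (fun n => ?_) (E_tendsto h0 h1)
    have e : A n t / n - ((K n t : ℝ) / n + 1 / n) = (A n t - ((K n t : ℝ) + 1)) / n := by ring
    rw [e, Real.norm_eq_abs, abs_div, Nat.abs_cast]
    gcongr
    exact A_sub n t
  simpa using hd.add hK

lemma D_tendsto {t : ℝ} (h0 : 0 ≤ t) (h1 : t ≤ 1) :
    Tendsto (fun n : ℕ => D n t / (n : ℝ) ^ 2) atTop (𝓝 ((r t)⁻¹ ^ 2 / 2)) := by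
  have hK : Tendsto (fun n : ℕ => (K n t : ℝ) / n * ((K n t : ℝ) / n + 1 / n) / 2) atTop
      (𝓝 ((r t)⁻¹ * ((r t)⁻¹ + 0) / 2)) :=
    ((K_tendsto t).mul ((K_tendsto t).add tendsto_one_div_atTop_nhds_zero_nat)).div_const 2
  rw [add_zero, ← sq] at hK
  have hE : Tendsto (fun n : ℕ => 2 * (E n t / n)) atTop (𝓝 0) := by
    simpa using (E_tendsto h0 h1).const_mul 2
  have hd : Tendsto (fun n : ℕ => D n t / (n : ℝ) ^ 2
      - (K n t : ℝ) / n * ((K n t : ℝ) / n + 1 / n) / 2) atTop (𝓝 0) := by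
    refine squeeze_zero_norm (fun n => ?_) hE
    rcases Nat.eq_zero_or_pos n with rfl | hn
    · simp
    have hn' : (0:ℝ) < n := by exact_mod_cast hn
    have e : D n t / (n : ℝ) ^ 2 - (K n t : ℝ) / n * ((K n t : ℝ) / n + 1 / n) / 2
        = (D n t - (K n t : ℝ) * ((K n t : ℝ) + 1) / 2) / (n : ℝ) ^ 2 := by
      field_simp
    have e2 : 2 * (E n t / n) = 2 * n * E n t / (n : ℝ) ^ 2 := by field_simp
    rw [e, e2, Real.norm_eq_abs, abs_div, abs_of_pos (by positivity : (0:ℝ) < (n:ℝ) ^ 2)]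
    gcongr
    exact D_sub n t
  simpa using hd.add hK

lemma A_bound {t : ℝ} (h0 : 0 ≤ t) (h1 : t ≤ 1) (n : ℕ) : 0 ≤ A n t ∧ A n t ≤ 2 * n + 1 := by
  refine ⟨Finset.sum_nonneg fun m _ => G_nonneg h0 h1 n m, ?_⟩
  refine (Finset.sum_le_sum fun m _ => G_le h0 h1 n m).trans ?_
  simp

lemma D_bound {t : ℝ} (h0 : 0 ≤ t) (h1 : t ≤ 1) (n : ℕ) :
    0 ≤ D n t ∧ D n t ≤ 2 * n * (2 * n + 1) := by
  refine ⟨Finset.sum_nonneg fun m _ => mul_nonneg (by positivity) (G_nonneg h0 h1 n m), ?_⟩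
  refine le_trans ?_ (mul_le_mul_of_nonneg_left (A_bound h0 h1 n).2 (by positivity))
  rw [A, Finset.mul_sum]
  refine Finset.sum_le_sum fun m hm => mul_le_mul_of_nonneg_right ?_ (G_nonneg h0 h1 n m)
  have hm : m ≤ 2 * n := by simpa [Nat.lt_succ_iff] using hm
  exact_mod_cast hm

lemma integral_r : ∫ t in (0:ℝ)..1, (r t)⁻¹ ^ 3 = 2 := by
  have := intervalIntegral.integral_eq_sub_of_hasDerivAt (a := (0:ℝ)) (b := 1)
    (f := fun t : ℝ => (2 * t - 1) / r t) (f' := fun t : ℝ => (r t)⁻¹ ^ 3) ?_ ?_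
  · rw [this]; norm_num [r]
  · intro t _
    have hr := r_pos t
    have hr2 := r_sq t
    have hq : HasDerivAt (fun t : ℝ => t ^ 2 + (1 - t) ^ 2) (4 * t - 2) t := by
      have h1 := hasDerivAt_pow 2 t
      have h2 := ((hasDerivAt_id t).const_sub 1).pow 2
      refine HasDerivAt.congr_deriv (h1.add h2) ?_
      simp
      ring
    have hq0 : t ^ 2 + (1 - t) ^ 2 ≠ 0 := by rw [← hr2]; positivity
    have hs : HasDerivAt r ((4 * t - 2) / (2 * r t)) t := hq.sqrt hq0
    have hl : HasDerivAt (fun t : ℝ => 2 * t - 1) 2 t := by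
      simpa using ((hasDerivAt_id t).const_mul 2).sub_const 1
    refine HasDerivAt.congr_deriv (hl.div hs hr.ne') ?_
    field_simp
    rw [hr2]; ring
  · apply Continuous.intervalIntegrable
    exact (r_cont.inv₀ fun t => (r_pos t).ne').pow 3

end GridFlowAux

open GridFlowAux in
theorem grid_flow_asymptotic :
    Tendsto (fun n : ℕ => gridFlow n / (n : ℝ) ^ 3) atTop (nhds 2) := by
  rw [← integral_r]
  have e : ∀ n : ℕ, gridFlow n / (n : ℝ) ^ 3
      = ∫ t in (0:ℝ)..1, (2 * (A n t * D n t) + A n t ^ 2) / (n : ℝ) ^ 3 := by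
    intro n
    rw [intervalIntegral.integral_div, gridFlow_eq]
  simp_rw [e]
  apply intervalIntegral.tendsto_integral_filter_of_dominated_convergence (fun _ => (45:ℝ))
  · refine Eventually.of_forall fun n => Continuous.aestronglyMeasurable ?_
    have := A_cont n
    have := D_cont n
    fun_prop
  · filter_upwards [eventually_gt_atTop 0] with n hn
    refine Eventually.of_forall fun t ht => ?_
    rw [Set.uIoc_of_le zero_le_one] at ht
    have hn' : (1:ℝ) ≤ n := by exact_mod_cast hn
    obtain ⟨a0, a1⟩ := A_bound ht.1.le ht.2 n
    obtain ⟨d0, d1⟩ := D_bound ht.1.le ht.2 n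
    rw [Real.norm_eq_abs, abs_of_nonneg (by positivity), div_le_iff₀ (by positivity)]
    have a2 : A n t ≤ 3 * n := by linarith
    have d2 : D n t ≤ 6 * (n:ℝ) ^ 2 := by nlinarith
    have h1 : A n t * D n t ≤ (3 * n) * (6 * (n:ℝ) ^ 2) := by gcongr
    have h2 : A n t ^ 2 ≤ (3 * (n:ℝ)) ^ 2 := by gcongr
    have h3 : (n:ℝ) ^ 2 ≤ (n:ℝ) ^ 3 := pow_le_pow_right₀ hn' (by norm_num)
    nlinarith
  · exact intervalIntegrable_const
  · refine Eventually.of_forall fun t ht => ?_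
    rw [Set.uIoc_of_le zero_le_one] at ht
    have hA := A_tendsto ht.1.le ht.2
    have hD := D_tendsto ht.1.le ht.2
    have h := ((hA.mul hD).const_mul 2).add
      ((hA.pow 2).mul (tendsto_one_div_atTop_nhds_zero_nat (𝕜 := ℝ)))
    have e1 : 2 * ((r t)⁻¹ * ((r t)⁻¹ ^ 2 / 2)) + (r t)⁻¹ ^ 2 * 0 = (r t)⁻¹ ^ 3 := by ring
    rw [e1] at h
    refine h.congr' ?_
    filter_upwards [eventually_gt_atTop 0] with n hn
    have hn' : (0:ℝ) < n := by exact_mod_cast hn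
    field_simp
end

section
/- Let T₁ and T₂ be independent exponential random variables of rate 1/4, and let U be independent of (T₁, T₂) with probability density (2/√3)·cos(u) on (0, π/3). Then E[T₁ + T₂ + T₁·sec(U)] = 8·(1 + π/(3√3)) and E[(T₁ + T₂ + T₁·sec(U))²] = 32·(3 + (2/√3)·(π + log(2 + √3))). -/
open Real MeasureTheory ProbabilityTheory

lemma exp_integral (f : ℝ → ℝ) :
    ∫ x, f x ∂(expMeasure (1 / 4)) = ∫ x in Set.Ioi (0:ℝ), f x * (1 / 4 * exp (-(1 / 4 * x))) := by
  have h : expMeasure (1 / 4) = volume.withDensity (exponentialPDF (1 / 4)) := rfl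
  rw [h, integral_withDensity_eq_integral_toReal_smul]
  · rw [← integral_Ici_eq_integral_Ioi, ← integral_indicator measurableSet_Ici]
    congr 1
    ext x
    by_cases hx : 0 ≤ x
    · rw [Set.indicator_of_mem (by exact hx), exponentialPDF_of_nonneg hx,
        ENNReal.toReal_ofReal (by positivity), smul_eq_mul, mul_comm]
    · rw [Set.indicator_of_notMem (by exact hx), exponentialPDF_of_neg (not_le.1 hx)]
      simp
  · exact (measurable_exponentialPDFReal _).ennreal_ofReal
  · exact Filter.Eventually.of_forall fun x => ENNReal.ofReal_lt_top

lemma exp_m1 : ∫ x, x ∂(expMeasure (1 / 4)) = 4 := by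
  rw [exp_integral]
  have h := Real.integral_rpow_mul_exp_neg_mul_Ioi (a := 2) (r := 1 / 4) (by norm_num) (by norm_num)
  have e : ∀ x : ℝ, x * (1 / 4 * exp (-(1 / 4 * x))) =
      1 / 4 * (x ^ ((2:ℝ) - 1) * exp (-(1 / 4 * x))) := by
    intro x
    rw [show (2:ℝ) - 1 = 1 by norm_num, rpow_one]; ring
  simp_rw [e]
  rw [integral_const_mul, h, show (2:ℝ) = ((1:ℕ):ℝ) + 1 by norm_num, Real.Gamma_nat_eq_factorial,
    show ((1:ℕ):ℝ) + 1 = ((2:ℕ):ℝ) by norm_num, rpow_natCast]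
  norm_num

lemma exp_m2 : ∫ x, x ^ 2 ∂(expMeasure (1 / 4)) = 32 := by
  rw [exp_integral]
  have h := Real.integral_rpow_mul_exp_neg_mul_Ioi (a := 3) (r := 1 / 4) (by norm_num) (by norm_num)
  have e : ∀ x : ℝ, x ^ 2 * (1 / 4 * exp (-(1 / 4 * x))) =
      1 / 4 * (x ^ ((3:ℝ) - 1) * exp (-(1 / 4 * x))) := by
    intro x
    rw [show (3:ℝ) - 1 = ((2:ℕ):ℝ) by norm_num, rpow_natCast]; ring
  simp_rw [e]
  rw [integral_const_mul, h, show (3:ℝ) = ((2:ℕ):ℝ) + 1 by norm_num, Real.Gamma_nat_eq_factorial,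
    show ((2:ℕ):ℝ) + 1 = ((3:ℕ):ℝ) by norm_num, rpow_natCast]
  norm_num [Nat.factorial]

lemma cos_pos_aux {x : ℝ} (h0 : 0 ≤ x) (h1 : x ≤ π / 3) : 0 < cos x :=
  cos_pos_of_mem_Ioo ⟨by linarith [pi_pos], by linarith [pi_pos]⟩

lemma u_integral (f : ℝ → ℝ) :
    ∫ x, f x ∂(volume.withDensity (fun u =>
      ENNReal.ofReal (Set.indicator (Set.Ioo (0 : ℝ) (π / 3))
        (fun u => 2 / Real.sqrt 3 * Real.cos u) u))) =
    ∫ x in (0:ℝ)..(π / 3), f x * (2 / √3 * cos x) := by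
  rw [integral_withDensity_eq_integral_toReal_smul]
  · rw [intervalIntegral.integral_of_le (by positivity), integral_Ioc_eq_integral_Ioo,
      ← integral_indicator measurableSet_Ioo]
    congr 1
    ext x
    by_cases hx : x ∈ Set.Ioo 0 (π / 3)
    · have := cos_pos_aux hx.1.le hx.2.le
      rw [Set.indicator_of_mem hx, Set.indicator_of_mem hx,
        ENNReal.toReal_ofReal (by positivity), smul_eq_mul, mul_comm]
    · rw [Set.indicator_of_notMem hx, Set.indicator_of_notMem hx]
      simp
  · exact (Measurable.indicator (by fun_prop) measurableSet_Ioo).ennreal_ofReal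
  · exact Filter.Eventually.of_forall fun x => ENNReal.ofReal_lt_top

lemma u_m1 : ∫ x in (0:ℝ)..(π / 3), (1 / cos x) * (2 / √3 * cos x) = 2 * π / (3 * √3) := by
  have : ∫ x in (0:ℝ)..(π / 3), (1 / cos x) * (2 / √3 * cos x) =
      ∫ x in (0:ℝ)..(π / 3), 2 / √3 := by
    apply intervalIntegral.integral_congr
    intro x hx
    rw [Set.uIcc_of_le (by positivity)] at hx
    have := cos_pos_aux hx.1 hx.2
    simp only
    field_simp
  rw [this, intervalIntegral.integral_const, smul_eq_mul]
  field_simp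
  ring

lemma u_m2 : ∫ x in (0:ℝ)..(π / 3), (1 / cos x) ^ 2 * (2 / √3 * cos x) =
    2 / √3 * log (2 + √3) := by
  have : ∫ x in (0:ℝ)..(π / 3), (1 / cos x) ^ 2 * (2 / √3 * cos x) =
      ∫ x in (0:ℝ)..(π / 3), 2 / √3 * (1 / cos x) := by
    apply intervalIntegral.integral_congr
    intro x hx
    rw [Set.uIcc_of_le (by positivity)] at hx
    have := cos_pos_aux hx.1 hx.2
    simp only
    field_simp
  rw [this, intervalIntegral.integral_const_mul]
  congr 1
  rw [intervalIntegral.integral_eq_sub_of_hasDerivAt (f := fun x => log (1 + sin x) - log (cos x))]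
  · simp only [sin_pi_div_three, cos_pi_div_three, sin_zero, cos_zero, add_zero, log_one, sub_zero]
    rw [← log_div (by positivity) (by norm_num)]
    congr 1
    ring
  · intro x hx
    rw [Set.uIcc_of_le (by positivity)] at hx
    have hc := cos_pos_aux hx.1 hx.2
    have hs : 0 ≤ sin x := sin_nonneg_of_nonneg_of_le_pi hx.1 (by linarith [hx.2, pi_pos])
    have h1 : 1 + sin x ≠ 0 := by positivity
    have := (((hasDerivAt_sin x).const_add 1).log h1).sub ((hasDerivAt_cos x).log hc.ne')
    refine HasDerivAt.congr_deriv (f := fun x => log (1 + sin x) - log (cos x)) this ?_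
    symm
    rw [neg_div, sub_neg_eq_add, div_add_div _ _ h1 hc.ne', div_eq_div_iff hc.ne'
      (mul_ne_zero h1 hc.ne')]
    linear_combination -cos x * sin_sq_add_cos_sq x
  · apply ContinuousOn.intervalIntegrable
    intro x hx
    rw [Set.uIcc_of_le (by positivity)] at hx
    have hc := cos_pos_aux hx.1 hx.2
    exact (continuousAt_const.div continuous_cos.continuousAt hc.ne').continuousWithinAt

theorem initial_segment_moments
    {Ω : Type*} [MeasurableSpace Ω] (μ : Measure Ω) [IsProbabilityMeasure μ]
    (T₁ T₂ U : Ω → ℝ)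
    (hT₁ : Measurable T₁) (hT₂ : Measurable T₂) (hU : Measurable U)
    (hT₁law : Measure.map T₁ μ = expMeasure (1 / 4))
    (hT₂law : Measure.map T₂ μ = expMeasure (1 / 4))
    (hUlaw : Measure.map U μ = volume.withDensity (fun u =>
      ENNReal.ofReal (Set.indicator (Set.Ioo (0 : ℝ) (π / 3))
        (fun u => 2 / Real.sqrt 3 * Real.cos u) u)))
    (hindep : IndepFun T₁ T₂ μ)
    (hindepU : IndepFun (fun ω => (T₁ ω, T₂ ω)) U μ) :
    (∫ ω, (T₁ ω + T₂ ω + T₁ ω * (1 / Real.cos (U ω))) ∂μ)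
        = 8 * (1 + π / (3 * Real.sqrt 3)) ∧
    (∫ ω, (T₁ ω + T₂ ω + T₁ ω * (1 / Real.cos (U ω))) ^ 2 ∂μ)
        = 32 * (3 + 2 / Real.sqrt 3 * (π + Real.log (2 + Real.sqrt 3))) := by
  have key : ∀ {f : Ω → ℝ} {c : ℝ}, ∫ ω, f ω ∂μ = c → 0 < c → Integrable f μ := by
    intro f c h hc
    by_contra hn
    rw [integral_undef hn] at h
    exact hc.ne h
  have a1 : ∫ ω, T₁ ω ∂μ = 4 := by
    rw [← exp_m1, ← hT₁law, integral_map hT₁.aemeasurable (by fun_prop)]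
  have a2 : ∫ ω, T₁ ω ^ 2 ∂μ = 32 := by
    rw [← exp_m2, ← hT₁law, integral_map hT₁.aemeasurable (by fun_prop)]
  have b1 : ∫ ω, T₂ ω ∂μ = 4 := by
    rw [← exp_m1, ← hT₂law, integral_map hT₂.aemeasurable (by fun_prop)]
  have b2 : ∫ ω, T₂ ω ^ 2 ∂μ = 32 := by
    rw [← exp_m2, ← hT₂law, integral_map hT₂.aemeasurable (by fun_prop)]
  have mS : Measurable fun u : ℝ => 1 / cos u := by fun_prop
  have s1 : ∫ ω, 1 / cos (U ω) ∂μ = 2 * π / (3 * √3) := by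
    rw [← u_m1, ← u_integral (fun u => 1 / cos u), ← hUlaw,
      integral_map hU.aemeasurable mS.aestronglyMeasurable]
  have s2 : ∫ ω, (1 / cos (U ω)) ^ 2 ∂μ = 2 / √3 * log (2 + √3) := by
    rw [← u_m2, ← u_integral (fun u => (1 / cos u) ^ 2), ← hUlaw,
      integral_map hU.aemeasurable (mS.pow_const 2).aestronglyMeasurable]
  have hlog : 0 < log (2 + √3) := log_pos (by linarith [sqrt_nonneg (3:ℝ)])
  have mSU : Measurable fun ω => 1 / cos (U ω) := mS.comp hU
  -- product expectations with a function of `U`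
  have prodU : ∀ (g : ℝ × ℝ → ℝ) (h : ℝ → ℝ), Measurable g → Measurable h →
      ∫ ω, g (T₁ ω, T₂ ω) * h (1 / cos (U ω)) ∂μ =
        (∫ ω, g (T₁ ω, T₂ ω) ∂μ) * ∫ ω, h (1 / cos (U ω)) ∂μ := by
    intro g h hg hh
    have hi := hindepU.comp hg (hh.comp mS)
    exact hi.integral_fun_mul_eq_mul_integral
      (hg.comp (hT₁.prodMk hT₂)).aestronglyMeasurable
      ((hh.comp mS).comp hU).aestronglyMeasurable
  have ab : ∫ ω, T₁ ω * T₂ ω ∂μ = 16 := by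
    rw [hindep.integral_fun_mul_eq_mul_integral hT₁.aestronglyMeasurable
      hT₂.aestronglyMeasurable, a1, b1]; norm_num
  have as1 : ∫ ω, T₁ ω * (1 / cos (U ω)) ∂μ = 4 * (2 * π / (3 * √3)) := by
    rw [← a1, ← s1]
    exact prodU (fun p => p.1) (fun s => s) (by fun_prop) (by fun_prop)
  have aas1 : ∫ ω, T₁ ω ^ 2 * (1 / cos (U ω)) ∂μ = 32 * (2 * π / (3 * √3)) := by
    rw [← a2, ← s1]
    exact prodU (fun p => p.1 ^ 2) (fun s => s) (by fun_prop) (by fun_prop)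
  have aas2 : ∫ ω, T₁ ω ^ 2 * (1 / cos (U ω)) ^ 2 ∂μ = 32 * (2 / √3 * log (2 + √3)) := by
    rw [← a2, ← s2]
    exact prodU (fun p => p.1 ^ 2) (fun s => s ^ 2) (by fun_prop) (by fun_prop)
  have abs1 : ∫ ω, T₁ ω * T₂ ω * (1 / cos (U ω)) ∂μ = 16 * (2 * π / (3 * √3)) := by
    rw [← ab, ← s1]
    exact prodU (fun p => p.1 * p.2) (fun s => s) (by fun_prop) (by fun_prop)
  have ia1 := key a1 (by norm_num)
  have ia2 := key a2 (by norm_num)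
  have ib1 := key b1 (by norm_num)
  have ib2 := key b2 (by norm_num)
  have iab := key ab (by norm_num)
  have ias1 := key as1 (by positivity)
  have iaas1 := key aas1 (by positivity)
  have iaas2 := key aas2 (by positivity)
  have iabs1 := key abs1 (by positivity)
  have add : ∀ {f g : Ω → ℝ}, Integrable f μ → Integrable g μ →
      Integrable (fun ω => f ω + g ω) μ := fun h1 h2 => h1.add h2
  constructor
  · rw [integral_add (add ia1 ib1) ias1, integral_add ia1 ib1, a1, b1, as1]
    field_simp
    ring
  · have e : ∀ ω, (T₁ ω + T₂ ω + T₁ ω * (1 / cos (U ω))) ^ 2 =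
        T₁ ω ^ 2 + T₂ ω ^ 2 + T₁ ω ^ 2 * (1 / cos (U ω)) ^ 2 + 2 * (T₁ ω * T₂ ω)
        + 2 * (T₁ ω ^ 2 * (1 / cos (U ω))) + 2 * (T₁ ω * T₂ ω * (1 / cos (U ω))) := by
      intro ω; ring
    have i1 := add ia2 ib2
    have i2 := add i1 iaas2
    have i3 := add i2 (iab.const_mul 2)
    have i4 := add i3 (iaas1.const_mul 2)
    simp_rw [e]
    rw [integral_add i4 (iabs1.const_mul 2), integral_add i3 (iaas1.const_mul 2),
      integral_add i2 (iab.const_mul 2), integral_add i1 iaas2, integral_add ia2 ib2,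
      integral_const_mul, integral_const_mul, integral_const_mul,
      a2, b2, aas2, ab, aas1, abs1]
    field_simp
    ring
end
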